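/- There exists an absolute constant c₂ > 0 such that for every τ > 0 and every real random variable ξ with E ξ = 0 whose distribution F belongs to the class A₁(τ), there exists a coupling π of F and the Gaussian law Φ_F satisfying ∫ (exp(|x − y|/(c₂ τ)) − 1) dπ(x,y) ≤ 1; equivalently, the Wasserstein distance W_ψ(F, Φ_F) associated with the Orlicz function ψ(x) = exp(|x|) − 1 is at most c₂ τ. -/

import Mathlib

open MeasureTheory ProbabilityTheory

noncomputable section

/-- `φ` is the cumulant generating function (analytic logarithm of the Laplace transform,
normalized by `φ 0 = 0`) of `μ` on the disc `{z : ‖z‖ * τ < 1}`, with third derivative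
bounded by `τ · Var μ`.  This is the defining property of the class `A₁(τ)`. -/
def IsCGF (φ : ℂ → ℂ) (τ : ℝ) (μ : Measure ℝ) : Prop :=
  φ 0 = 0 ∧ ∀ z : ℂ, ‖z‖ * τ < 1 →
    Integrable (fun x : ℝ => Complex.exp (z * x)) μ ∧
    Complex.exp (φ z) = ∫ x : ℝ, Complex.exp (z * x) ∂μ ∧
    AnalyticAt ℂ φ z ∧
    ‖iteratedDeriv 3 φ z‖ ≤ τ * variance id μ

/-- The class `A₁(τ)` of distributions on `ℝ`. -/
def MemA1 (τ : ℝ) (μ : Measure ℝ) : Prop := ∃ φ : ℂ → ℂ, IsCGF φ τ μ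

/-- `π` is a coupling of `F` and `G`. -/
def IsCoupling (π : Measure (ℝ × ℝ)) (F G : Measure ℝ) : Prop :=
  π.map Prod.fst = F ∧ π.map Prod.snd = G

namespace OW
open Set Filter Topology

/-- The Fejer-type kernel, a nonnegative function with compactly supported Fourier transform. -/
def ker (u : ℝ) : ℝ := 2 * ∫ t in (0:ℝ)..(1/2), (1 - 2*t) * Real.cos (t*u)

lemma ker_eq {u : ℝ} (hu : u ≠ 0) : ker u = 4 * (1 - Real.cos (u/2)) / u^2 := by
  unfold ker
  have h : ∀ t ∈ uIcc (0:ℝ) (1/2), HasDerivAt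
      (fun t => (1 - 2*t) * Real.sin (t*u) / u - 2 * Real.cos (t*u) / u^2)
      ((1 - 2*t) * Real.cos (t*u)) t := by
    intro t _
    have h1 : HasDerivAt (fun t : ℝ => t*u) u t := by simpa using (hasDerivAt_id t).mul_const u
    have h2 := h1.sin
    have h3 := h1.cos
    have h4 : HasDerivAt (fun t : ℝ => 1 - 2*t) (-2) t := by
      simpa using ((hasDerivAt_id t).const_mul 2).const_sub 1
    have := ((h4.mul h2).div_const u).sub ((h3.const_mul 2).div_const (u^2))
    exact this.congr_deriv (by field_simp; ring)
  rw [intervalIntegral.integral_eq_sub_of_hasDerivAt h]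
  · have : (1/2:ℝ)*u = u/2 := by ring
    simp only [this]
    norm_num
    field_simp
    ring
  · apply Continuous.intervalIntegrable
    fun_prop

lemma ker_zero : ker 0 = 1/2 := by
  unfold ker
  simp only [mul_zero, Real.cos_zero, mul_one]
  rw [intervalIntegral.integral_sub (by simp) (by apply Continuous.intervalIntegrable; fun_prop)]
  rw [intervalIntegral.integral_const_mul]
  simp
  norm_num

lemma ker_nonneg (u : ℝ) : 0 ≤ ker u := by
  by_cases hu : u = 0
  · rw [hu, ker_zero]; norm_num
  · rw [ker_eq hu]
    have := Real.cos_le_one (u/2)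
    positivity [sub_nonneg.2 this]

lemma ker_continuous : Continuous ker := by
  unfold ker
  refine continuous_const.mul ?_
  apply intervalIntegral.continuous_parametric_intervalIntegral_of_continuous'
  fun_prop

lemma ker_le (u : ℝ) : ker u ≤ 9 * (1 + u^2)⁻¹ := by
  by_cases hu : u = 0
  · rw [hu, ker_zero]; norm_num
  · rw [ker_eq hu]
    have h1 := Real.neg_one_le_cos (u/2)
    have h2 := Real.one_sub_sq_div_two_le_cos (x := u/2)
    have hu2 : 0 < u^2 := by positivity
    rw [← div_eq_mul_inv, div_le_div_iff₀ hu2 (by positivity)]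
    nlinarith

lemma ker_integrable : Integrable ker := by
  refine (integrable_inv_one_add_sq.const_mul 9).mono' ker_continuous.aestronglyMeasurable ?_
  filter_upwards with u
  rw [Real.norm_of_nonneg (ker_nonneg u)]
  exact ker_le u

def kerM : ℝ := ∫ u, ker u

lemma kerM_pos : 0 < kerM := by
  unfold kerM
  refine integral_pos_of_integrable_nonneg_nonzero (x := 0) ker_continuous ker_integrable
    ker_nonneg ?_
  rw [ker_zero]; norm_num

lemma exists_kerA : ∃ A : ℝ, 0 < A ∧ (3/4) * kerM ≤ ∫ u in Icc (-A) A, ker u := by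
  have h := intervalIntegral_tendsto_integral ker_integrable tendsto_neg_atTop_atBot tendsto_id
  have h2 := h.eventually (lt_mem_nhds (show (3/4) * kerM < ∫ u, ker u by
    have := kerM_pos; unfold kerM at *; linarith))
  obtain ⟨A, hA, hA'⟩ := (h2.and (eventually_gt_atTop 0)).exists
  refine ⟨A, hA', ?_⟩
  rw [intervalIntegral.integral_of_le (by simp; linarith)] at hA
  rw [integral_Icc_eq_integral_Ioc]
  exact hA.le

lemma integral_cos_eq (t v : ℝ) : ∫ w in (0:ℝ)..v, Real.cos (t*w) = v * Real.sinc (t*v) := by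
  by_cases ht : t = 0
  · subst ht; simp
  by_cases hv : v = 0
  · subst hv; simp
  rw [intervalIntegral.integral_comp_mul_left _ ht, Real.sinc_of_ne_zero (by positivity)]
  simp
  field_simp

lemma integral_ker_eq (v : ℝ) : ∫ w in (0:ℝ)..v, ker w
    = 2 * ∫ t in (0:ℝ)..(1/2), (1 - 2*t) * (v * Real.sinc (t*v)) := by
  unfold ker
  rw [intervalIntegral.integral_const_mul]
  congr 1
  rw [intervalIntegral_intervalIntegral_swap]
  · congr 1
    ext t
    rw [intervalIntegral.integral_const_mul, integral_cos_eq]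
  · refine IntegrableOn.mono_set (t := uIcc 0 v ×ˢ uIcc 0 (1/2)) ?_
      (prod_mono uIoc_subset_uIcc uIoc_subset_uIcc)
    refine ContinuousOn.integrableOn_compact (isCompact_uIcc.prod isCompact_uIcc) ?_
    apply Continuous.continuousOn
    unfold Function.uncurry
    fun_prop

lemma smooth_eq (μ : Measure ℝ) [IsProbabilityMeasure μ] (hμ : Integrable (fun x : ℝ => x) μ)
    (u : ℝ) : ∫ w, μ.real (Iic (u - w)) * ker w = (∫ w in Iic (0:ℝ), ker w) +
      2 * ∫ t in (0:ℝ)..(1/2), (1 - 2*t) * ∫ x, (u - x) * Real.sinc (t*(u-x)) ∂μ ∧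
      IntervalIntegrable (fun t => (1 - 2*t) * ∫ x, (u - x) * Real.sinc (t*(u-x)) ∂μ)
        volume 0 (1/2) := by
  have hA : ∫ w, μ.real (Iic (u - w)) * ker w = ∫ x, (∫ w in Iic (u - x), ker w) ∂μ := by
    have h1 : ∀ w, μ.real (Iic (u - w)) * ker w
        = ∫ x, ({p : ℝ × ℝ | p.1 + p.2 ≤ u}.indicator (fun p => ker p.1) (w, x)) ∂μ := by
      intro w
      rw [← integral_indicator_one measurableSet_Iic, ← integral_mul_const]
      congr 1; ext x
      by_cases hx : w + x ≤ u
      · have : x ≤ u - w := by linarith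
        simp [hx, this, indicator]
      · have : ¬ x ≤ u - w := by intro h; apply hx; linarith
        simp [hx, this, indicator]
    have h2 : ∀ x, ∫ w in Iic (u - x), ker w
        = ∫ w, ({p : ℝ × ℝ | p.1 + p.2 ≤ u}.indicator (fun p => ker p.1) (w, x)) := by
      intro x
      rw [← integral_indicator measurableSet_Iic]
      congr 1; ext w
      by_cases hx : w + x ≤ u
      · have : w ≤ u - x := by linarith
        simp [hx, this, indicator]
      · have : ¬ w ≤ u - x := by intro h; apply hx; linarith
        simp [hx, this, indicator]
    rw [integral_congr_ae (ae_of_all _ h1), integral_congr_ae (ae_of_all _ h2)]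
    apply integral_integral_swap
    refine Integrable.indicator ?_ ?_
    · exact ker_integrable.comp_fst μ
    · exact measurableSet_le (by fun_prop) (by fun_prop)
  have hB : ∀ v, ∫ w in Iic v, ker w = (∫ w in Iic (0:ℝ), ker w) + ∫ w in (0:ℝ)..v, ker w := by
    intro v
    rw [← intervalIntegral.integral_Iic_sub_Iic ker_integrable.integrableOn
      ker_integrable.integrableOn]
    ring
  rw [hA]
  have hE : ∀ x, ∫ w in Iic (u - x), ker w = (∫ w in Iic (0:ℝ), ker w) +
      2 * ∫ t in (0:ℝ)..(1/2), (1 - 2*t) * ((u - x) * Real.sinc (t*(u-x))) := fun x => by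
    rw [hB, integral_ker_eq]
  rw [integral_congr_ae (ae_of_all _ hE)]
  have hint : Integrable (Function.uncurry fun (t x : ℝ) => (1 - 2*t) * ((u - x) * Real.sinc (t*(u-x))))
      ((volume.restrict (uIoc (0:ℝ) (1/2))).prod μ) := by
    have hc : Continuous Real.sinc := Real.continuous_sinc
    have : IsFiniteMeasure (volume.restrict (uIoc (0:ℝ) (1/2))) := by
      rw [uIoc_of_le (by norm_num)]; infer_instance
    have h1 : Integrable (fun x : ℝ => |u| + |x|) μ := (integrable_const _).add hμ.abs
    have h2 : Integrable (fun p : ℝ × ℝ => |u| + |p.2|)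
      ((volume.restrict (uIoc (0:ℝ) (1/2))).prod μ) := h1.comp_snd _
    refine h2.mono' (Continuous.aestronglyMeasurable (by unfold Function.uncurry; fun_prop)) ?_
    have : ∀ᵐ p ∂((volume.restrict (uIoc (0:ℝ) (1/2))).prod μ), p.1 ∈ uIoc (0:ℝ) (1/2) := by
      have := (Measure.quasiMeasurePreserving_fst (μ := volume.restrict (uIoc (0:ℝ) (1/2))) (ν := μ)).ae
        (ae_restrict_mem measurableSet_uIoc)
      exact this
    filter_upwards [this] with p hp
    rw [uIoc_of_le (by norm_num)] at hp
    simp only [Function.uncurry, norm_mul, Real.norm_eq_abs]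
    have h3 : |1 - 2*p.1| ≤ 1 := by rw [abs_le]; constructor <;> linarith [hp.1, hp.2]
    have h4 : |Real.sinc (p.1*(u-p.2))| ≤ 1 := Real.abs_sinc_le_one _
    have h5 : |u - p.2| ≤ |u| + |p.2| := abs_sub _ _
    calc _ ≤ 1 * ((|u| + |p.2|) * 1) := by gcongr
      _ = _ := by ring
  refine ⟨?_, ?_⟩
  swap
  · rw [intervalIntegrable_iff]
    have := hint.integral_prod_left
    simp only [Function.uncurry, integral_const_mul] at this
    exact this
  rw [integral_add (integrable_const _)]
  · simp_rw [← integral_const_mul]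
    rw [intervalIntegral_integral_swap hint]
    simp
    rw [integral_const_mul]
  · refine Integrable.const_mul ?_ 2
    have := hint.swap.integral_prod_left
    simp only [intervalIntegral.integral_of_le (show (0:ℝ) ≤ 1/2 by norm_num)]
    rw [uIoc_of_le (by norm_num)] at this
    exact this

lemma sin_diff (μ ν : Measure ℝ) [IsProbabilityMeasure μ] [IsProbabilityMeasure ν] (u t : ℝ) :
    |∫ x, Real.sin (t*(u-x)) ∂μ - ∫ x, Real.sin (t*(u-x)) ∂ν| ≤ ‖charFun μ t - charFun ν t‖ := by
  have key : ∀ (μ : Measure ℝ) [IsProbabilityMeasure μ], ∫ x, Real.sin (t*(u-x)) ∂μ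
      = - (Complex.exp (-(t*u) * Complex.I) * charFun μ t).im := by
    intro μ _
    rw [charFun_apply_real, ← integral_const_mul]
    have hi : Integrable (fun x : ℝ => Complex.exp (-(t*u) * Complex.I) * Complex.exp (t*x*Complex.I)) μ := by
      refine (integrable_const (1:ℝ)).mono' (Continuous.aestronglyMeasurable (by fun_prop)) ?_
      filter_upwards with x
      rw [← Complex.exp_add, Complex.norm_exp]
      simp
    have := integral_im hi
    simp only [RCLike.im_eq_complex_im] at this
    rw [← this, ← integral_neg]
    congr 1; ext x
    rw [← Complex.exp_add]
    have : (-(t*u) * Complex.I + t*x*Complex.I) = ((-(t*(u-x)) : ℝ) : ℂ) * Complex.I := by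
      push_cast; ring
    rw [this, Complex.exp_ofReal_mul_I_im, Real.sin_neg]; ring
  rw [key μ, key ν]
  have : -(Complex.exp (-(t*u) * Complex.I) * charFun μ t).im - -(Complex.exp (-(t*u) * Complex.I) * charFun ν t).im
     = -(Complex.exp (-(t*u) * Complex.I) * (charFun μ t - charFun ν t)).im := by
    rw [mul_sub, Complex.sub_im]; ring
  rw [this, abs_neg]
  refine (Complex.abs_im_le_norm _).trans ?_
  rw [norm_mul, Complex.norm_exp]
  simp

lemma cdf_ker_integrable (μ : Measure ℝ) [IsProbabilityMeasure μ] (u : ℝ) :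
    Integrable (fun w => μ.real (Iic (u - w)) * ker w) := by
  have hm : Antitone (fun w => μ.real (Iic (u - w))) := by
    intro a b hab
    exact measureReal_mono (Iic_subset_Iic.2 (by linarith))
  refine ker_integrable.mono' (hm.measurable.aestronglyMeasurable.mul
    ker_continuous.aestronglyMeasurable) ?_
  filter_upwards with w
  rw [norm_mul, Real.norm_of_nonneg (ker_nonneg w), Real.norm_of_nonneg measureReal_nonneg]
  have := ker_nonneg w
  have h2 : μ.real (Iic (u - w)) ≤ 1 := measureReal_le_one
  nlinarith

lemma smooth_bound (μ ν : Measure ℝ) [IsProbabilityMeasure μ] [IsProbabilityMeasure ν]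
    (hμ : Integrable (fun x : ℝ => x) μ) (hν : Integrable (fun x : ℝ => x) ν)
    (b : ℝ → ℝ) (hb : IntervalIntegrable b volume 0 (1/2))
    (hc : ∀ t ∈ Ioc (0:ℝ) (1/2), ‖charFun μ t - charFun ν t‖ ≤ t * b t) (u : ℝ) :
    |∫ w, (μ.real (Iic (u - w)) - ν.real (Iic (u - w))) * ker w|
      ≤ 2 * ∫ t in (0:ℝ)..(1/2), b t := by
  simp_rw [sub_mul]
  rw [integral_sub (cdf_ker_integrable μ u) (cdf_ker_integrable ν u)]
  obtain ⟨h1, h1'⟩ := smooth_eq μ hμ u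
  obtain ⟨h2, h2'⟩ := smooth_eq ν hν u
  rw [h1, h2, add_sub_add_left_eq_sub, ← mul_sub, ← intervalIntegral.integral_sub h1' h2', abs_mul,
    abs_of_pos (by norm_num : (0:ℝ) < 2)]
  refine mul_le_mul_of_nonneg_left ?_ (by norm_num)
  rw [← Real.norm_eq_abs]
  refine intervalIntegral.norm_integral_le_of_norm_le (by norm_num) ?_ hb
  filter_upwards with t ht
  have ht0 : 0 < t := ht.1
  have e : ∀ μ : Measure ℝ, ∫ x, (u - x) * Real.sinc (t*(u-x)) ∂μ
      = (∫ x, Real.sin (t*(u-x)) ∂μ) / t := by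
    intro μ
    rw [← integral_div]
    congr 1; ext x
    by_cases hx : u - x = 0
    · simp [hx]
    · rw [Real.sinc_of_ne_zero (by positivity)]
      field_simp
  rw [e, e, ← mul_sub, ← sub_div, norm_mul, norm_div, Real.norm_of_nonneg ht0.le, Real.norm_eq_abs,
    Real.norm_eq_abs]
  have h3 : |1 - 2*t| ≤ 1 := by rw [abs_le]; constructor <;> linarith [ht.1, ht.2]
  have h4 := (sin_diff μ ν u t).trans (hc t ht)
  calc _ ≤ 1 * (t * b t / t) := by gcongr
    _ = b t := by field_simp

lemma esseen : ∃ C : ℝ, 0 < C ∧ ∀ (μ ν : Measure ℝ), IsProbabilityMeasure μ →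
    IsProbabilityMeasure ν → Integrable (fun x : ℝ => x) μ → Integrable (fun x : ℝ => x) ν →
    ∀ L : ℝ, 0 ≤ L → (∀ a b, a ≤ b → ν.real (Iic b) - ν.real (Iic a) ≤ L * (b - a)) →
    ∀ b : ℝ → ℝ, IntervalIntegrable b volume 0 (1/2) →
    (∀ t ∈ Ioc (0:ℝ) (1/2), ‖charFun μ t - charFun ν t‖ ≤ t * b t) →
    ∀ x, |μ.real (Iic x) - ν.real (Iic x)| ≤ C * (L + ∫ t in (0:ℝ)..(1/2), b t) := by
  obtain ⟨A, hA, hAM⟩ := exists_kerA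
  have hM := kerM_pos
  refine ⟨3*A + 4/kerM, by positivity, ?_⟩
  intro μ ν _ _ hμ hν L hL hLip b hb hc
  set D : ℝ → ℝ := fun x => μ.real (Iic x) - ν.real (Iic x) with hD
  set B := ∫ t in (0:ℝ)..(1/2), b t with hB
  have hJ := smooth_bound μ ν hμ hν b hb hc
  have hB0 : 0 ≤ 2*B := (abs_nonneg _).trans (hJ 0)
  have hbdd : BddAbove (range fun x => |D x|) := by
    refine ⟨1, ?_⟩
    rintro _ ⟨x, rfl⟩
    have h1 : μ.real (Iic x) ≤ 1 := measureReal_le_one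
    have h2 : ν.real (Iic x) ≤ 1 := measureReal_le_one
    have h3 : 0 ≤ μ.real (Iic x) := measureReal_nonneg
    have h4 : 0 ≤ ν.real (Iic x) := measureReal_nonneg
    simp only [hD, abs_le]; constructor <;> linarith
  set S := ⨆ x, |D x| with hS
  have hDS : ∀ x, |D x| ≤ S := fun x => le_ciSup hbdd x
  have hS0 : 0 ≤ S := (abs_nonneg _).trans (hDS 0)
  set m := ∫ u in Icc (-A) A, ker u with hm
  have hmono : ∀ x y, x ≤ y → μ.real (Iic x) ≤ μ.real (Iic y) := fun x y h =>
    measureReal_mono (Iic_subset_Iic.2 h)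
  have hDint : ∀ u, Integrable (fun w => D (u - w) * ker w) := by
    intro u
    simp only [hD, sub_mul]
    exact (cdf_ker_integrable μ u).sub (cdf_ker_integrable ν u)
  -- main estimate for a lower bound
  have main : ∀ (e x : ℝ), (e = 1 ∨ e = -1) → 2*A*L ≤ e * D x →
      (∀ w ∈ Icc (-A) A, e * D x - 2*A*L ≤ e * D (x + e*A - w)) →
      (e * D x - 2*A*L) * (3/4*kerM) - S*kerM/4 ≤ 2*B := by
    intro e x he h0 hw
    have h1 : ∫ w, (-S + (Icc (-A) A).indicator (fun _ => e * D x - 2*A*L + S) w) * ker w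
        ≤ ∫ w, e * (D (x + e*A - w) * ker w) := by
      refine integral_mono ?_ ((hDint _).const_mul e) ?_
      · have : (fun w => (-S + (Icc (-A) A).indicator (fun _ => e * D x - 2*A*L + S) w) * ker w)
          = fun w => -S * ker w + (Icc (-A) A).indicator (fun w => (e * D x - 2*A*L + S) * ker w) w := by
          ext w
          by_cases hw : w ∈ Icc (-A) A
          · simp only [indicator_of_mem hw]; ring
          · simp only [indicator_of_notMem hw]; ring
        rw [this]
        exact (ker_integrable.const_mul _).add ((ker_integrable.const_mul _).indicator measurableSet_Icc)
      · intro w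
        simp only
        have hk := ker_nonneg w
        rw [← mul_assoc]
        refine mul_le_mul_of_nonneg_right ?_ hk
        by_cases hw' : w ∈ Icc (-A) A
        · simp only [indicator_of_mem hw']; linarith [hw w hw']
        · simp only [indicator_of_notMem hw']
          have := hDS (x + e*A - w)
          rw [abs_le] at this
          rcases he with rfl | rfl <;> linarith
    have h2 : ∫ w, (-S + (Icc (-A) A).indicator (fun _ => e * D x - 2*A*L + S) w) * ker w
        = -S * kerM + (e * D x - 2*A*L + S) * m := by
      have : (fun w => (-S + (Icc (-A) A).indicator (fun _ => e * D x - 2*A*L + S) w) * ker w)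
          = fun w => -S * ker w + (Icc (-A) A).indicator (fun w => (e * D x - 2*A*L + S) * ker w) w := by
        ext w
        by_cases hw : w ∈ Icc (-A) A
        · simp only [indicator_of_mem hw]; ring
        · simp only [indicator_of_notMem hw]; ring
      rw [this, integral_add (ker_integrable.const_mul _)
        ((ker_integrable.const_mul _).indicator measurableSet_Icc), integral_const_mul,
        integral_indicator measurableSet_Icc, integral_const_mul]
      rfl
    have h3 : ∫ w, e * (D (x + e*A - w) * ker w) ≤ 2*B := by
      rw [integral_const_mul]
      have := hJ (x + e*A)
      rw [abs_le] at this
      rcases he with rfl | rfl <;> linarith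
    rw [h2] at h1
    have h4 : (e * D x - 2*A*L + S) * (3/4*kerM) ≤ (e * D x - 2*A*L + S) * m :=
      mul_le_mul_of_nonneg_left hAM (by linarith)
    nlinarith
  have step : ∀ x, |D x| ≤ 2*A*L + 8/(3*kerM)*B + S/3 := by
    intro x
    by_cases hx : |D x| ≤ 2*A*L
    · have : 0 ≤ 8/(3*kerM)*B := by
        have : 0 ≤ B := by linarith
        positivity
      linarith
    push Not at hx
    have fin : (|D x| - 2*A*L) * (3/4*kerM) - S*kerM/4 ≤ 2*B → |D x| ≤ 2*A*L + 8/(3*kerM)*B + S/3 := by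
      intro h
      have : |D x| - 2*A*L ≤ (2*B + S*kerM/4)/(3/4*kerM) := by
        rw [le_div_iff₀ (by positivity)]; linarith
      have e : (2*B + S*kerM/4)/(3/4*kerM) = 8/(3*kerM)*B + S/3 := by field_simp; ring
      linarith
    rcases le_total 0 (D x) with h | h
    · rw [abs_of_nonneg h] at hx fin ⊢
      apply fin
      have := main 1 x (Or.inl rfl) (by linarith) ?_
      · simpa using this
      · intro w hw
        have h1 := hmono x (x + 1*A - w) (by linarith [hw.2])
        have h2 := hLip x (x + 1*A - w) (by linarith [hw.2])
        have h3 : L * (x + 1*A - w - x) ≤ L * (2*A) := mul_le_mul_of_nonneg_left (by linarith [hw.1]) hL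
        simp only [hD]; linarith
    · rw [abs_of_nonpos h] at hx fin ⊢
      apply fin
      have := main (-1) x (Or.inr rfl) (by linarith) ?_
      · linarith
      · intro w hw
        have h1 := hmono (x + (-1)*A - w) x (by linarith [hw.1])
        have h2 := hLip (x + (-1)*A - w) x (by linarith [hw.1])
        have h3 : L * (x - (x + (-1)*A - w)) ≤ L * (2*A) := mul_le_mul_of_nonneg_left (by linarith [hw.2]) hL
        simp only [hD]; linarith
  have hSle : S ≤ 2*A*L + 8/(3*kerM)*B + S/3 := ciSup_le step
  intro x
  refine (hDS x).trans ?_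
  have h5 : S ≤ 3*A*L + 4/kerM*B := by
    have : 8/(3*kerM)*B = (2/3) * (4/kerM*B) := by field_simp; ring
    linarith
  have h6 : 0 ≤ B := by linarith
  have h7 : 0 ≤ 4/kerM*L := by positivity
  have h8 : 0 ≤ 3*A*B := by positivity
  calc S ≤ 3*A*L + 4/kerM*B := h5
    _ ≤ _ := by ring_nf at h7 h8 ⊢; linarith
end OW

namespace OW
open Set Filter Topology

/-- Scaled analytic hypothesis. -/
def Good (F : Measure ℝ) (s : ℝ) : Prop :=
  ∃ q : ℂ → ℂ, q 0 = 0 ∧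
    (∀ z : ℂ, ‖z‖ < 1 → Integrable (fun x : ℝ => Complex.exp (z * x)) F ∧
      ∫ x : ℝ, Complex.exp (z * x) ∂F = Complex.exp (s^2 * z^2 / 2 + q z)) ∧
    (∀ (z w : ℂ) (r : ℝ), r < 1 → ‖z‖ ≤ r → ‖w‖ ≤ r → ‖q z - q w‖ ≤ s^2/2 * r^2 * ‖z - w‖)

def lam (F : Measure ℝ) (h : ℝ) : ℝ := Real.log (∫ x, Real.exp (h * x) ∂F)

lemma Good.integrable {F : Measure ℝ} {s : ℝ} (hF : Good F s) {h : ℝ} (hh : |h| < 1) :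
    Integrable (fun x => Real.exp (h * x)) F := by
  obtain ⟨q, -, h1, -⟩ := hF
  have := (h1 h (by simpa using hh)).1.norm
  refine this.congr ?_
  filter_upwards with x
  rw [Complex.norm_exp]; simp

lemma Good.lam_aux {F : Measure ℝ} {s : ℝ} {q : ℂ → ℂ} {h : ℝ}
    (hF : ∫ x : ℝ, Complex.exp ((h:ℂ) * x) ∂F = Complex.exp (s^2 * (h:ℂ)^2 / 2 + q h)) :
    ∫ x, Real.exp (h * x) ∂F = Real.exp (s^2*h^2/2 + (q h).re) := by
  have e : ∫ x : ℝ, Complex.exp ((h:ℂ) * x) ∂F = ((∫ x, Real.exp (h * x) ∂F : ℝ) : ℂ) := by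
    rw [← integral_complex_ofReal]; congr 1; ext x; push_cast; rfl
  have hn : 0 ≤ ∫ x, Real.exp (h * x) ∂F := integral_nonneg fun x => (Real.exp_pos _).le
  have h2 : ‖((∫ x, Real.exp (h * x) ∂F : ℝ) : ℂ)‖ = ∫ x, Real.exp (h * x) ∂F := by
    rw [Complex.norm_real, Real.norm_of_nonneg hn]
  rw [← h2, ← e, hF, Complex.norm_exp]
  congr 1
  have : (s^2 * (h:ℂ)^2 / 2) = ((s^2*h^2/2 : ℝ) : ℂ) := by push_cast; ring
  rw [this, Complex.add_re, Complex.ofReal_re]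

lemma Good.exp_lam {F : Measure ℝ} {s : ℝ} (hF : Good F s) {h : ℝ} (hh : |h| < 1) :
    ∫ x, Real.exp (h * x) ∂F = Real.exp (lam F h) := by
  obtain ⟨q, -, h1, -⟩ := hF
  rw [lam, Good.lam_aux (h1 h (by simpa using hh)).2, Real.log_exp]

lemma Good.lam_diff {F : Measure ℝ} {s : ℝ} (hF : Good F s) {h k r : ℝ} (hr : r < 1)
    (hh : |h| ≤ r) (hk : |k| ≤ r) :
    |lam F h - lam F k - s^2*(h^2-k^2)/2| ≤ s^2/2*r^2*|h-k| := by
  obtain ⟨q, -, h1, h2⟩ := hF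
  have e1 := Good.lam_aux (h1 h (by simpa using hh.trans_lt hr)).2
  have e2 := Good.lam_aux (h1 k (by simpa using hk.trans_lt hr)).2
  rw [lam, lam, e1, e2, Real.log_exp, Real.log_exp]
  have h3 := h2 h k r hr (by simpa using hh) (by simpa using hk)
  have h4 := Complex.abs_re_le_norm (q h - q k)
  rw [Complex.sub_re] at h4
  have h5 : ‖(h:ℂ) - k‖ = |h - k| := by rw [← Complex.ofReal_sub, Complex.norm_real, Real.norm_eq_abs]
  rw [h5] at h3
  calc _ = |(q h).re - (q k).re| := by congr 1; ring
    _ ≤ _ := h4.trans h3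

lemma lam_zero (F : Measure ℝ) [IsProbabilityMeasure F] : lam F 0 = 0 := by simp [lam]

lemma Good.lam_bound {F : Measure ℝ} [IsProbabilityMeasure F] {s : ℝ} (hF : Good F s) {h : ℝ}
    (hh : |h| < 1) : |lam F h - s^2*h^2/2| ≤ s^2*|h|^3/2 := by
  have := hF.lam_diff (k := 0) hh le_rfl (by simp)
  rw [lam_zero] at this
  simp only [sub_zero] at this
  calc _ = |lam F h - s^2*(h^2-0^2)/2| := by congr 1; ring
    _ ≤ _ := this
    _ = _ := by ring

lemma Good.neg {F : Measure ℝ} {s : ℝ} (hF : Good F s) : Good (F.map (fun x => -x)) s := by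
  obtain ⟨q, h0, h1, h2⟩ := hF
  refine ⟨fun z => q (-z), by simpa using h0, ?_, ?_⟩
  · intro z hz
    obtain ⟨h3, h4⟩ := h1 (-z) (by simpa using hz)
    have hm : AEMeasurable (fun x : ℝ => -x) F := measurable_neg.aemeasurable
    have hc : ∀ μ : Measure ℝ, AEStronglyMeasurable (fun x : ℝ => Complex.exp (z * x)) μ :=
      fun μ => Continuous.aestronglyMeasurable (by fun_prop)
    rw [integrable_map_measure (hc _) hm, integral_map hm (hc _)]
    constructor
    · refine h3.congr (ae_of_all _ fun x => ?_)
      simp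
    · rw [show (s:ℂ)^2*z^2/2 = s^2*(-z)^2/2 by ring, ← h4]
      congr 1; ext x; simp
  · intro z w r hr hz hw
    have := h2 (-z) (-w) r hr (by simpa using hz) (by simpa using hw)
    rw [show -z - -w = -(z-w) by ring, norm_neg] at this
    exact this

def Fh (F : Measure ℝ) (h : ℝ) : Measure ℝ := F.tilted (fun x => h * x)

lemma Good.prob {F : Measure ℝ} [IsProbabilityMeasure F] {s : ℝ} (hF : Good F s) {h : ℝ}
    (hh : |h| < 1) : IsProbabilityMeasure (Fh F h) :=
  isProbabilityMeasure_tilted (hF.integrable hh)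

lemma Good.mem_interior {F : Measure ℝ} {s : ℝ} (hF : Good F s) {h : ℝ}
    (hh : |h| < 1) : h ∈ interior (integrableExpSet (id : ℝ → ℝ) F) := by
  rw [_root_.mem_interior]
  refine ⟨Ioo (-1) 1, ?_, isOpen_Ioo, abs_lt.1 hh⟩
  intro k hk
  exact hF.integrable (abs_lt.2 hk)

lemma Good.integrable_id {F : Measure ℝ} [IsProbabilityMeasure F] {s : ℝ} (hF : Good F s) {h : ℝ}
    (hh : |h| < 1) : Integrable (fun x => x) (Fh F h) := by
  have := memLp_tilted_mul (hF.mem_interior hh) 1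
  exact memLp_one_iff_integrable.1 (by exact_mod_cast this)

lemma Good.charFun {F : Measure ℝ} [IsProbabilityMeasure F] {s : ℝ} {q : ℂ → ℂ}
    (hF : ∀ z : ℂ, ‖z‖ < 1 → Integrable (fun x : ℝ => Complex.exp (z * x)) F ∧
      ∫ x : ℝ, Complex.exp (z * x) ∂F = Complex.exp (s^2 * z^2 / 2 + q z))
    {h t : ℝ} (hh : |h| ≤ 1/2) (ht : |t| ≤ 1/2) :
    charFun (Fh F h) t = Complex.exp (s^2 * (h + t*Complex.I)^2 / 2 + q (h + t*Complex.I)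
      - (s^2 * (h:ℂ)^2 / 2 + q h)) := by
  have h1 : ‖(h:ℂ)‖ < 1 := by simp; linarith
  have h2 : ‖(h:ℂ) + t*Complex.I‖ < 1 := by
    rw [Complex.norm_add_mul_I]
    rw [Real.sqrt_lt' (by norm_num)]
    nlinarith [abs_le.1 hh, abs_le.1 ht]
  have e : ((∫ x, Real.exp (h * x) ∂F : ℝ) : ℂ) = ∫ x : ℝ, Complex.exp ((h:ℂ) * x) ∂F := by
    rw [← integral_complex_ofReal]; congr 1; ext x; push_cast; rfl
  rw [charFun_apply_real, Fh, integral_tilted, Complex.exp_sub, ← (hF _ h1).2, ← (hF _ h2).2,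
    ← e, ← integral_div]
  congr 1; ext x
  rw [Complex.real_smul, Complex.ofReal_div, Complex.ofReal_exp, div_mul_eq_mul_div,
    ← Complex.exp_add]
  congr 2
  push_cast; ring

/-- Gaussian with variance `s ^ 2`. -/
def gs (m s : ℝ) : Measure ℝ := gaussianReal m (s^2).toNNReal

instance (m s : ℝ) : IsProbabilityMeasure (gs m s) := by unfold gs; infer_instance

lemma coe_sq (s : ℝ) : (((s^2).toNNReal : NNReal) : ℝ) = s^2 := Real.coe_toNNReal _ (sq_nonneg s)

lemma sq_toNNReal_ne {s : ℝ} (hs : 0 < s) : (s^2).toNNReal ≠ 0 := by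
  have : 0 < s^2 := by positivity
  simpa using hs.ne'

lemma gs_real {m s : ℝ} (hs : 0 < s) {A : Set ℝ} :
    (gs m s).real A = ∫ x in A, gaussianPDFReal m (s^2).toNNReal x := by
  rw [gs, Measure.real, gaussianReal_apply_eq_integral _ (sq_toNNReal_ne hs)]
  exact ENNReal.toReal_ofReal (integral_nonneg fun x => gaussianPDFReal_nonneg _ _ _)

lemma pdf_eq {m s : ℝ} (hs : 0 < s) (x : ℝ) : gaussianPDFReal m (s^2).toNNReal x
    = (√(2*Real.pi))⁻¹ / s * Real.exp (-(x-m)^2/(2*s^2)) := by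
  rw [gaussianPDFReal, coe_sq, Real.sqrt_mul (by positivity), Real.sqrt_sq hs.le]
  rw [mul_inv, div_eq_mul_inv (√(2*Real.pi))⁻¹ s]

lemma gs_Ioc_le {m s a b c : ℝ} (hs : 0 < s) (hab : a ≤ b)
    (hc : ∀ x ∈ Ioc a b, gaussianPDFReal m (s^2).toNNReal x ≤ c) :
    (gs m s).real (Ioc a b) ≤ c * (b - a) := by
  rw [gs_real hs]
  calc _ ≤ ∫ x in Ioc a b, c := setIntegral_mono_on (integrable_gaussianPDFReal _ _).integrableOn
        (by simp) measurableSet_Ioc hc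
    _ = _ := by simp [hab]; ring

lemma gs_Ioc_ge {m s a b c : ℝ} (hs : 0 < s) (hab : a ≤ b)
    (hc : ∀ x ∈ Ioc a b, c ≤ gaussianPDFReal m (s^2).toNNReal x) :
    c * (b - a) ≤ (gs m s).real (Ioc a b) := by
  rw [gs_real hs]
  calc _ = ∫ x in Ioc a b, c := by simp [hab]; ring
    _ ≤ _ := setIntegral_mono_on (by simp) (integrable_gaussianPDFReal _ _).integrableOn
        measurableSet_Ioc hc

lemma real_Iic_sub (μ : Measure ℝ) [IsProbabilityMeasure μ] {a b : ℝ} (hab : a ≤ b) :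
    μ.real (Iic b) - μ.real (Iic a) = μ.real (Ioc a b) := by
  have e : Ioc a b = Iic b \ Iic a := by ext x; simp [and_comm]
  rw [e, measureReal_diff (Iic_subset_Iic.2 hab) measurableSet_Iic]

lemma sqrt_two_pi_inv_le : (√(2*Real.pi))⁻¹ ≤ 1/2 := by
  have h3 := Real.pi_gt_three
  have : 2 ≤ √(2*Real.pi) := Real.le_sqrt_of_sq_le (by linarith)
  rw [one_div]
  exact inv_anti₀ (by norm_num) this

lemma gs_lip {m s a b : ℝ} (hs : 0 < s) (hab : a ≤ b) :
    (gs m s).real (Iic b) - (gs m s).real (Iic a) ≤ 1/s * (b - a) := by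
  rw [real_Iic_sub _ hab]
  refine gs_Ioc_le hs hab fun x _ => ?_
  rw [pdf_eq hs]
  have h1 : Real.exp (-(x-m)^2/(2*s^2)) ≤ 1 := by
    rw [Real.exp_le_one_iff]
    exact div_nonpos_of_nonpos_of_nonneg (by nlinarith [sq_nonneg (x-m)]) (by positivity)
  have h2 := sqrt_two_pi_inv_le
  calc _ ≤ (1:ℝ) / s * 1 := by gcongr; linarith
    _ = _ := by ring

lemma diff_bound {s h t : ℝ} (hs : 0 < s) (hsh : s*h^2 ≤ 1) (ht : 0 < t) (ht2 : t ≤ 1/2)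
    {w : ℝ} (hw0 : 0 ≤ w) (hw : w ≤ s^2/2*(h^2+t^2)*t) :
    Real.exp (-(s^2*t^2/2)) * (w * Real.exp w) ≤
      t * (Real.exp (1/2) * (s^2*h^2+16) * Real.exp (-(s^2/16) * t^2)) := by
  have h1 : w ≤ s^2*t^2*(3/8) + 1/2 := by
    have : s^2/2*(h^2+t^2)*t = (s*h^2)*(s*t)/2 + s^2*t^2*t/2 := by ring
    have h2 : (s*h^2)*(s*t) ≤ 1*(s*t) := by gcongr
    have h3 : s^2*t^2*t ≤ s^2*t^2*(1/2) := by gcongr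
    nlinarith [sq_nonneg (s*t/2 - 1)]
  have h2 : Real.exp (-(s^2*t^2/2)) * (w * Real.exp w) ≤
      (s^2/2*(h^2+t^2)*t) * (Real.exp (1/2) * Real.exp (-(s^2*t^2/8))) := by
    calc _ = w * (Real.exp (-(s^2*t^2/2)) * Real.exp w) := by ring
      _ = w * Real.exp (-(s^2*t^2/2) + w) := by rw [Real.exp_add]
      _ ≤ (s^2/2*(h^2+t^2)*t) * Real.exp (1/2 + -(s^2*t^2/8)) := by
          exact mul_le_mul hw (Real.exp_le_exp.2 (by linarith)) (Real.exp_pos _).le (by positivity)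
      _ = _ := by rw [Real.exp_add]
  refine h2.trans ?_
  have h3 : Real.exp (-(s^2*t^2/8)) = Real.exp (-(s^2/16)*t^2) * Real.exp (-(s^2*t^2/16)) := by
    rw [← Real.exp_add]; congr 1; ring
  have h4 : (s^2*t^2/16) * Real.exp (-(s^2*t^2/16)) ≤ 1 := by
    have := Real.add_one_le_exp (s^2*t^2/16)
    rw [Real.exp_neg, ← div_eq_mul_inv, div_le_one (Real.exp_pos _)]
    linarith
  have h5 : Real.exp (-(s^2*t^2/16)) ≤ 1 := by
    rw [Real.exp_le_one_iff]; have : 0 ≤ s^2*t^2/16 := by positivity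
    linarith
  have h6 : (s^2*h^2 + s^2*t^2) * Real.exp (-(s^2*t^2/16)) ≤ s^2*h^2 + 16 := by
    have : s^2*h^2 * Real.exp (-(s^2*t^2/16)) ≤ s^2*h^2*1 := by gcongr
    nlinarith
  rw [h3]
  have h7 : 0 ≤ s^2*h^2 + 16 := by positivity
  calc _ = t * (Real.exp (1/2) * (((s^2*h^2 + s^2*t^2) * Real.exp (-(s^2*t^2/16)))/2) * Real.exp (-(s^2/16)*t^2)) := by ring
    _ ≤ t * (Real.exp (1/2) * ((s^2*h^2 + 16)) * Real.exp (-(s^2/16)*t^2)) := by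
        gcongr; linarith

lemma ks_tilted : ∃ C : ℝ, 1 ≤ C ∧ ∀ (F : Measure ℝ) (s : ℝ), IsProbabilityMeasure F → 0 < s →
    Good F s → ∀ h : ℝ, |h| ≤ 1/2 → ∀ x, |(Fh F h).real (Iic x) - (gs (h*s^2) s).real (Iic x)|
      ≤ C * (1/s + s*h^2) := by
  obtain ⟨C, hC, hE⟩ := esseen
  set a : ℝ := Real.exp (1/2) * √(16*Real.pi) * 16 with ha
  have ha0 : 0 ≤ a := by positivity
  refine ⟨1 + C*(1+a), by nlinarith [mul_nonneg hC.le ha0], ?_⟩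
  intro F s _ hs hF h hh x
  have hh1 : |h| < 1 := by linarith
  have := hF.prob hh1
  have hX : 0 ≤ 1/s + s*h^2 := by positivity
  by_cases hsh : s*h^2 ≤ 1
  swap
  · have h1 : (Fh F h).real (Iic x) ≤ 1 := measureReal_le_one
    have h2 : (gs (h*s^2) s).real (Iic x) ≤ 1 := measureReal_le_one
    have h3 : 0 ≤ (Fh F h).real (Iic x) := measureReal_nonneg
    have h4 : 0 ≤ (gs (h*s^2) s).real (Iic x) := measureReal_nonneg
    push Not at hsh
    have h5 : 1 ≤ 1/s + s*h^2 := by have : 0 < 1/s := by positivity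
                                    linarith
    have h6 : 0 ≤ C*(1+a) := by positivity
    rw [abs_le]; constructor <;> nlinarith
  have hint := hF.integrable_id hh1
  set b : ℝ → ℝ := fun t => Real.exp (1/2) * (s^2*h^2+16) * Real.exp (-(s^2/16) * t^2) with hb
  have hbI : Integrable b := (integrable_exp_neg_mul_sq (by positivity)).const_mul _
  have hbB : ∫ t in (0:ℝ)..(1/2), b t ≤ a * (1/s + s*h^2) := by
    have h1 : ∫ t in (0:ℝ)..(1/2), b t ≤ ∫ t, b t := by
      rw [intervalIntegral.integral_of_le (by norm_num)]
      exact setIntegral_le_integral hbI (ae_of_all _ fun t => by simp only [hb]; positivity)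
    refine h1.trans ?_
    simp only [hb]
    rw [integral_const_mul, integral_gaussian]
    have h2 : √(Real.pi/(s^2/16)) = √(16*Real.pi)/s := by
      rw [show Real.pi/(s^2/16) = (16*Real.pi)/s^2 by field_simp, Real.sqrt_div (by positivity),
        Real.sqrt_sq hs.le]
    rw [h2, ha]
    have h3 : (s^2*h^2+16)/s ≤ 16*(1/s+s*h^2) := by
      have : (s^2*h^2+16)/s = s*h^2 + 16*(1/s) := by field_simp
      rw [this]
      have : 0 ≤ s*h^2 := by positivity
      linarith
    calc _ = Real.exp (1/2) * √(16*Real.pi) * ((s^2*h^2+16)/s) := by ring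
      _ ≤ Real.exp (1/2) * √(16*Real.pi) * (16*(1/s+s*h^2)) := by gcongr
      _ = _ := by ring
  have key := hE (Fh F h) (gs (h*s^2) s) inferInstance inferInstance hint ?_ (1/s) (by positivity)
    (fun a b hab => gs_lip hs hab) b hbI.intervalIntegrable ?_ x
  · refine key.trans ?_
    have h4 : 1/s ≤ 1/s + s*h^2 := by have : 0 ≤ s*h^2 := by positivity
                                      linarith
    calc _ ≤ C * ((1/s + s*h^2) + a * (1/s + s*h^2)) := by gcongr
      _ = C * (1+a) * (1/s + s*h^2) := by ring
      _ ≤ _ := by nlinarith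
  · have := memLp_id_gaussianReal (μ := h*s^2) (v := (s^2).toNNReal) 1
    exact memLp_one_iff_integrable.1 (by exact_mod_cast this)
  · intro t ht
    obtain ⟨q, h0, h1, h2⟩ := hF
    have ht' : |t| ≤ 1/2 := by rw [abs_of_pos ht.1]; exact ht.2
    rw [Good.charFun h1 hh ht', gs, charFun_gaussianReal]
    have hcs : ((((s^2).toNNReal : NNReal) : ℝ) : ℂ) = (s:ℂ)^2 := by rw [coe_sq]; push_cast; rfl
    have e1 : (s:ℂ)^2 * (h + t*Complex.I)^2 / 2 + q (h + t*Complex.I) - (s^2 * (h:ℂ)^2 / 2 + q h)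
        = (t * (h * s^2 : ℝ) * Complex.I - (((s^2).toNNReal : NNReal) : ℝ) * t^2/2)
          + (q (h + t*Complex.I) - q h) := by
      rw [hcs]; push_cast
      ring_nf
      simp only [Complex.I_sq]
      ring
    rw [e1, Complex.exp_add]
    set W := q (h + t*Complex.I) - q h with hW
    rw [← mul_sub_one, norm_mul]
    have e2 : ‖Complex.exp (t * (h * s^2 : ℝ) * Complex.I - (((s^2).toNNReal : NNReal) : ℝ) * t^2/2)‖
        = Real.exp (-(s^2*t^2/2)) := by
      rw [hcs, Complex.norm_exp]
      congr 1
      have : (t * ((h * s^2 : ℝ) : ℂ) * Complex.I - (s:ℂ)^2 * t^2/2)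
        = ((-(s^2*t^2/2) : ℝ) : ℂ) + ((t * (h*s^2) : ℝ) : ℂ) * Complex.I := by push_cast; ring
      rw [this, Complex.add_re, Complex.ofReal_re, Complex.re_ofReal_mul, Complex.I_re]
      ring
    have e3 : ‖Complex.exp W - 1‖ ≤ ‖W‖ * Real.exp ‖W‖ := by
      have := Complex.norm_exp_sub_sum_le_norm_mul_exp W 1
      simpa using this
    have e4 : ‖W‖ ≤ s^2/2*(h^2+t^2)*t := by
      have hn : ‖(h:ℂ) + t*Complex.I‖ = √(h^2+t^2) := Complex.norm_add_mul_I _ _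
      have hr : √(h^2+t^2) < 1 := by
        rw [Real.sqrt_lt' (by norm_num)]
        nlinarith [abs_le.1 hh, abs_le.1 ht']
      have := h2 (h + t*Complex.I) h (√(h^2+t^2)) hr hn.le (by
        rw [Complex.norm_real, Real.norm_eq_abs]
        exact Real.abs_le_sqrt (by nlinarith [sq_nonneg t]))
      rw [Real.sq_sqrt (by positivity)] at this
      have e5 : ‖(h:ℂ) + t*Complex.I - h‖ = t := by
        rw [add_sub_cancel_left, norm_mul, Complex.norm_I, Complex.norm_real, Real.norm_eq_abs,
          abs_of_pos ht.1, mul_one]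
      rwa [e5] at this
    rw [e2]
    refine le_trans ?_ (diff_bound hs hsh ht.1 ht.2 (norm_nonneg W) e4)
    gcongr
end OW

namespace OW
open Set Filter Topology

lemma layer_aux {h x : ℝ} (hh : 0 < h) {t : ℝ} (ht : t ∈ Ioc (0:ℝ) 1) :
    {u : ℝ | t ≤ (Ioi x).indicator (fun u => Real.exp (-h*(u-x))) u} = Ioc x (x - Real.log t / h) := by
  ext u
  by_cases hu : x < u
  · simp only [mem_ofPred_eq, mem_Ioc, hu, true_and, mem_Ioi, indicator_of_mem]
    rw [← Real.log_le_iff_le_exp ht.1, le_sub_iff_add_le, ← le_sub_iff_add_le', div_le_iff₀ hh]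
    constructor <;> intro h' <;> linarith
  · simp only [mem_ofPred_eq, mem_Ioc, hu, false_and, mem_Ioi, not_false_iff, indicator_of_notMem]
    simpa using ht.1

lemma layer_int {μ : Measure ℝ} [IsProbabilityMeasure μ] {h : ℝ} (hh : 0 < h) (x : ℝ) :
    Integrable ((Ioi x).indicator (fun u => Real.exp (-h*(u-x)))) μ := by
  refine Integrable.of_bound (C := 1) ?_ (ae_of_all _ fun u => ?_)
  · exact (Measurable.indicator (by fun_prop) measurableSet_Ioi).aestronglyMeasurable
  · by_cases hu : u ∈ Ioi x
    · rw [indicator_of_mem hu, Real.norm_eq_abs, Real.abs_exp, Real.exp_le_one_iff]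
      have : x < u := hu
      nlinarith
    · rw [indicator_of_notMem hu]; simp

lemma layer_mono {μ : Measure ℝ} [IsProbabilityMeasure μ] {h : ℝ} (hh : 0 < h) (x : ℝ) :
    (∫ u, (Ioi x).indicator (fun u => Real.exp (-h*(u-x))) u ∂μ)
      = ∫ t in Ioc (0:ℝ) 1, μ.real (Ioc x (x - Real.log t / h)) := by
  rw [Integrable.integral_eq_integral_Ioc_meas_le (M := 1) (layer_int hh x)]
  · exact setIntegral_congr_fun measurableSet_Ioc fun t ht => by
      simp only [layer_aux hh ht]
  · exact ae_of_all _ fun u => indicator_nonneg (fun _ _ => (Real.exp_pos _).le) u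
  · refine ae_of_all _ fun u => ?_
    by_cases hu : u ∈ Ioi x
    · rw [indicator_of_mem hu, Real.exp_le_one_iff]
      have : x < u := hu
      nlinarith
    · rw [indicator_of_notMem hu]; simp

lemma layer_intble {μ : Measure ℝ} [IsProbabilityMeasure μ] {h : ℝ} (hh : 0 < h) (x : ℝ) :
    IntegrableOn (fun t => μ.real (Ioc x (x - Real.log t / h))) (Ioc (0:ℝ) 1) := by
  refine Integrable.of_bound (C := 1) ?_ ?_
  · have : ∀ t, t ∈ Ioc (0:ℝ) 1 → μ.real (Ioc x (x - Real.log t / h)) =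
      μ.real (Iic (x - Real.log t / h)) - μ.real (Iic x) := fun t ht => by
        rw [real_Iic_sub]
        have := Real.log_nonpos ht.1.le ht.2
        have := div_nonpos_of_nonpos_of_nonneg this hh.le
        linarith
    have hm : Measurable (fun t => μ.real (Iic (x - Real.log t / h)) - μ.real (Iic x)) := by
      have h1 : Monotone (fun a => μ.real (Iic a)) := fun a b hab =>
        measureReal_mono (Iic_subset_Iic.2 hab)
      exact (h1.measurable.comp (by fun_prop)).sub_const _
    refine AEStronglyMeasurable.congr hm.aestronglyMeasurable ?_
    filter_upwards [ae_restrict_mem measurableSet_Ioc] with t ht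
    exact (this t ht).symm
  · refine ae_of_all _ fun t => ?_
    rw [Real.norm_eq_abs, abs_of_nonneg measureReal_nonneg]
    exact measureReal_le_one

lemma layer {μ ν : Measure ℝ} [IsProbabilityMeasure μ] [IsProbabilityMeasure ν] {κ h : ℝ}
    (hκ : ∀ x, |μ.real (Iic x) - ν.real (Iic x)| ≤ κ) (hh : 0 < h) (x : ℝ) :
    |(∫ u in Ioi x, Real.exp (-h*u) ∂μ) - (∫ u in Ioi x, Real.exp (-h*u) ∂ν)|
      ≤ 2*κ*Real.exp (-h*x) := by
  have e : ∀ ρ : Measure ℝ, (∫ u in Ioi x, Real.exp (-h*u) ∂ρ)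
      = Real.exp (-h*x) * ∫ u, (Ioi x).indicator (fun u => Real.exp (-h*(u-x))) u ∂ρ := by
    intro ρ
    rw [integral_indicator measurableSet_Ioi, ← integral_const_mul]
    congr 1; ext u; rw [← Real.exp_add]; congr 1; ring
  rw [e, e, ← mul_sub, abs_mul, Real.abs_exp, mul_comm]
  gcongr
  rw [layer_mono hh, layer_mono hh, ← integral_sub (layer_intble hh x) (layer_intble hh x)]
  have := norm_setIntegral_le_of_norm_le_const (μ := volume) (s := Ioc (0:ℝ) 1) (C := 2*κ)
    (f := fun t => μ.real (Ioc x (x - Real.log t / h)) - ν.real (Ioc x (x - Real.log t / h)))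
    (by simp) ?_
  · simpa using this
  · intro t ht
    have h1 := Real.log_nonpos ht.1.le ht.2
    have h2 := div_nonpos_of_nonpos_of_nonneg h1 hh.le
    rw [← real_Iic_sub _ (by linarith), ← real_Iic_sub _ (by linarith), Real.norm_eq_abs]
    have h3 := abs_le.1 (hκ x)
    have h4 := abs_le.1 (hκ (x - Real.log t / h))
    rw [abs_le]; constructor <;> linarith

lemma Good.tilt_set {F : Measure ℝ} [IsProbabilityMeasure F] {s : ℝ} (hF : Good F s) {h : ℝ}
    (hh : |h| < 1) (A : Set ℝ) :
    (∫ u in A, Real.exp (-h*u) ∂(Fh F h)) = Real.exp (-lam F h) * F.real A := by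
  rw [Fh, setIntegral_tilted, hF.exp_lam hh]
  have : ∀ u, (Real.exp (h*u) / Real.exp (lam F h)) • Real.exp (-h*u) = Real.exp (-lam F h) := by
    intro u
    rw [smul_eq_mul, ← Real.exp_sub, ← Real.exp_add]; congr 1; ring
  simp only [this]
  simp [mul_comm]

lemma gs_tilt_set {s h : ℝ} (hs : 0 < s) {A : Set ℝ} (hA : MeasurableSet A) :
    (∫ u in A, Real.exp (-h*u) ∂(gs (h*s^2) s)) = Real.exp (-(s^2*h^2/2)) * (gs 0 s).real A := by
  rw [gs_real hs, ← integral_indicator hA, gs,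
    integral_gaussianReal_eq_integral_smul (sq_toNNReal_ne hs), ← integral_const_mul,
    ← integral_indicator hA]
  congr 1; ext u
  by_cases hu : u ∈ A
  · simp only [hu, indicator_of_mem, smul_eq_mul]
    rw [pdf_eq hs, pdf_eq hs, mul_assoc, ← Real.exp_add, mul_left_comm, ← Real.exp_add]
    congr 2
    field_simp; ring
  · simp [hu]

lemma main_ineq {C : ℝ} (hC : ∀ (F : Measure ℝ) (s : ℝ), IsProbabilityMeasure F → 0 < s →
    Good F s → ∀ h : ℝ, |h| ≤ 1/2 → ∀ x, |(Fh F h).real (Iic x) - (gs (h*s^2) s).real (Iic x)|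
      ≤ C * (1/s + s*h^2))
    {F : Measure ℝ} [IsProbabilityMeasure F] {s : ℝ} (hs : 0 < s) (hF : Good F s) {h : ℝ}
    (hh0 : 0 < h) (hh : h ≤ 1/2) (x : ℝ) :
    |Real.exp (-lam F h) * F.real (Ioi x) - Real.exp (-(s^2*h^2/2)) * (gs 0 s).real (Ioi x)|
      ≤ 2*(C * (1/s + s*h^2))*Real.exp (-h*x) := by
  have hh1 : |h| ≤ 1/2 := by rwa [abs_of_pos hh0]
  have := hF.prob (h := h) (by linarith)
  rw [← hF.tilt_set (by linarith), ← gs_tilt_set hs measurableSet_Ioi]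
  exact layer (hC F s ‹_› hs hF h hh1) hh0 x

/-- Gaussian tail upper bound. -/
lemma gs_tail {s h r : ℝ} (hs : 0 < s) (hh : 0 < h) :
    (gs 0 s).real (Ioi (h*s^2+r)) ≤ Real.exp (-(s^2*h^2/2)) * Real.exp (-(h*r)) / (2*s*h) := by
  rw [gs_real hs]
  have h1 : ∀ x, gaussianPDFReal 0 (s^2).toNNReal x
      ≤ (1/2)/s * Real.exp (s^2*h^2/2) * Real.exp (-h * x) := by
    intro x
    rw [pdf_eq hs, mul_assoc, ← Real.exp_add]
    have h2 := sqrt_two_pi_inv_le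
    gcongr
    rw [div_le_iff₀ (by positivity)]
    nlinarith [sq_nonneg (x - h*s^2)]
  have h2 := integrableOn_exp_mul_Ioi (neg_lt_zero.2 hh) (h*s^2+r)
  calc _ ≤ ∫ x in Ioi (h*s^2+r), (1/2)/s * Real.exp (s^2*h^2/2) * Real.exp (-h * x) :=
        setIntegral_mono (integrable_gaussianPDFReal _ _).integrableOn (h2.const_mul _) h1
    _ = _ := by
        rw [integral_const_mul, integral_exp_mul_Ioi (neg_lt_zero.2 hh)]
        have : Real.exp (s^2*h^2/2) * Real.exp (-h * (h*s^2+r))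
          = Real.exp (-(s^2*h^2/2)) * Real.exp (-(h*r)) := by
          rw [← Real.exp_add, ← Real.exp_add]; congr 1; ring
        rw [← this]; field_simp

lemma Ioi_split (μ : Measure ℝ) [IsProbabilityMeasure μ] {a b : ℝ} (hab : a ≤ b) :
    μ.real (Ioi a) = μ.real (Ioc a b) + μ.real (Ioi b) := by
  rw [← Ioc_union_Ioi_eq_Ioi hab, measureReal_union (by
    rw [Set.disjoint_left]; intro x hx hx2; exact absurd hx.2 (not_le.2 hx2)) measurableSet_Ioi]

lemma exp_sub_one_le (e : ℝ) : Real.exp e - 1 ≤ e * Real.exp e := by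
  have := Real.add_one_le_exp (-e)
  have h2 := Real.exp_pos e
  have h3 : Real.exp (-e) * Real.exp e = 1 := by rw [← Real.exp_add]; simp
  nlinarith

/-- window constant -/
def cB : ℝ := (√(2*Real.pi))⁻¹ * Real.exp (-(24^2/2))

lemma cB_pos : 0 < cB := by unfold cB; positivity

lemma cB_le : cB ≤ 1/2 := by
  have h1 := sqrt_two_pi_inv_le
  have h2 : Real.exp (-(24^2/2)) ≤ 1 := by rw [Real.exp_le_one_iff]; norm_num
  unfold cB
  calc _ ≤ (1/2:ℝ) * 1 := by gcongr
    _ = _ := by ring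

/-- Window mass lower bound. -/
lemma gs_win {s h l : ℝ} (hs : 0 < s) (hh : 0 ≤ h) (hl : 0 ≤ l) (hls : l ≤ s) :
    Real.exp (-(s^2*h^2/2)) * Real.exp (-(h*l)) * (l * cB / s) ≤
      (gs 0 s).real (Ioc (h*s^2) (h*s^2+l)) := by
  refine le_trans (le_of_eq ?_) (gs_Ioc_ge (c := Real.exp (-(s^2*h^2/2)) * Real.exp (-(h*l)) *
    (cB / s)) hs (by linarith) ?_)
  · ring
  · intro x hx
    rw [pdf_eq hs, cB, mul_div_right_comm (√(2*Real.pi))⁻¹, mul_left_comm, ← Real.exp_add, ← Real.exp_add]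
    gcongr
    set w := x - h*s^2 with hw
    have hw0 : 0 ≤ w := by linarith [hx.1]
    have hw1 : w ≤ l := by linarith [hx.2]
    have : x = h*s^2 + w := by ring
    rw [this]
    have e : -(h*s^2 + w - 0)^2/(2*s^2) = -(s^2*h^2/2) - h*w - w^2/(2*s^2) := by
      field_simp; ring
    rw [e]
    have h1 : h*w ≤ h*l := by gcongr
    have h2 : w^2/(2*s^2) ≤ 24^2/2 := by
      rw [div_le_iff₀ (by positivity)]; nlinarith
    linarith

lemma gs_win2 {s m a b : ℝ} (hs : 0 < s) (hab : a ≤ b) (hbm : b ≤ m) (ha : m - 24*s ≤ a) :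
    (b-a) * cB / s ≤ (gs m s).real (Ioc a b) := by
  refine le_trans (le_of_eq ?_) (gs_Ioc_ge (c := cB / s) hs hab ?_)
  · ring
  · intro x hx
    rw [pdf_eq hs, cB, mul_div_right_comm]
    gcongr
    rw [le_div_iff₀ (by positivity)]
    nlinarith [hx.1, hx.2]
end OW

namespace OW
open Set Filter Topology

/-- Kolmogorov hypothesis with constant `C`. -/
def KS (C : ℝ) : Prop := ∀ (F : Measure ℝ) (s : ℝ), IsProbabilityMeasure F → 0 < s →
    Good F s → ∀ h : ℝ, |h| ≤ 1/2 → ∀ x, |(Fh F h).real (Iic x) - (gs (h*s^2) s).real (Iic x)|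
      ≤ C * (1/s + s*h^2)

set_option maxHeartbeats 2000000 in
lemma upper {C₁ C : ℝ} (hC₁ : 1 ≤ C₁) (hK : KS C₁) (hC1 : 1 ≤ C) (hC : 6*C₁ < C*cB)
    {F : Measure ℝ} [IsProbabilityMeasure F] {s : ℝ} (hs : C ≤ s) (hF : Good F s) {h : ℝ}
    (hh0 : 0 < h) (hh : h ≤ 1/2) :
    F.real (Ioi (h*s^2 + C*(1+s^2*h^2))) < (gs 0 s).real (Ioi (h*s^2)) := by
  have hs0 : 0 < s := by linarith
  have hcB := cB_pos
  set D := C*(1+s^2*h^2) with hD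
  set g := Real.exp (-(s^2*h^2/2)) with hg
  have hg0 : 0 < g := Real.exp_pos _
  have hsh0 : 0 ≤ s^2*h^2 := by positivity
  have hD0 : 0 < D := by positivity
  have hDsh : s^2*h^2 ≤ D := by nlinarith
  set κ := C₁*(1/s+s*h^2) with hκ
  have hκD : κ * s * C = C₁ * D := by rw [hκ, hD]; field_simp
  have hκ0 : 0 < κ := by positivity
  have hκ1 : s*h^2 ≤ κ := by
    have : 0 < 1/s := by positivity
    have : 0 ≤ s*h^2 := by positivity
    nlinarith
  set e := s^2*h^3/2 with he
  have he0 : 0 ≤ e := by positivity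
  have heD : e ≤ h*D/2 := by
    have : h*(s^2*h^2) ≤ h*D := by gcongr
    have : e = h*(s^2*h^2)/2 := by rw [he]; ring
    linarith
  have hlam := abs_le.1 (hF.lam_bound (h := h) (by rw [abs_of_pos hh0]; linarith))
  rw [abs_of_pos hh0] at hlam
  have hm := (abs_le.1 (main_ineq hK hs0 hF hh0 hh (h*s^2+D))).2
  set p := F.real (Ioi (h*s^2+D)) with hp
  set q := (gs 0 s).real (Ioi (h*s^2+D)) with hq
  have hq0 : 0 ≤ q := measureReal_nonneg
  -- F tail bound
  have h1 : p ≤ Real.exp e * q + 2*κ*Real.exp e * g * Real.exp (-(h*D)) := by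
    have e1 : p = Real.exp (lam F h) * (Real.exp (-lam F h) * p) := by
      rw [← mul_assoc, ← Real.exp_add]; simp
    rw [e1]
    calc _ ≤ Real.exp (lam F h) * (g * q + 2*κ*Real.exp (-h*(h*s^2+D))) := by
          gcongr; linarith
      _ = Real.exp (lam F h) * g * q + 2*κ*(Real.exp (lam F h) * Real.exp (-h*(h*s^2+D))) := by ring
      _ ≤ Real.exp e * q + 2*κ*(Real.exp e * g * Real.exp (-(h*D))) := by
          rw [hg, ← Real.exp_add, ← Real.exp_add, ← Real.exp_add, ← Real.exp_add]
          have a1 : lam F h + -(s^2*h^2/2) ≤ e := by linarith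
          have a2 : lam F h + -h*(h*s^2+D) ≤ e + -(s^2*h^2/2) + -(h*D) := by nlinarith
          have b1 := Real.exp_le_exp.2 a1
          have b2 := Real.exp_le_exp.2 a2
          gcongr
      _ = _ := by ring
  have h2 : (Real.exp e - 1) * q ≤ κ * Real.exp e * g * Real.exp (-(h*D)) := by
    have a1 := gs_tail (r := D) hs0 hh0
    have a2 := exp_sub_one_le e
    calc _ ≤ (e * Real.exp e) * (g * Real.exp (-(h*D)) / (2*s*h)) := by gcongr
      _ = (s*h^2/4) * Real.exp e * g * Real.exp (-(h*D)) := by rw [he]; field_simp; ring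
      _ ≤ _ := by gcongr; have : 0 ≤ s*h^2 := by positivity
                  linarith
  have h3 : Real.exp e * g * Real.exp (-(h*D)) ≤ g * Real.exp (-(h*D/2)) := by
    rw [hg, ← Real.exp_add, ← Real.exp_add, ← Real.exp_add]
    apply Real.exp_le_exp.2; linarith
  have h4 : p - q ≤ 3*κ*(g * Real.exp (-(h*D/2))) := by
    have : κ * (Real.exp e * g * Real.exp (-(h*D))) ≤ κ * (g * Real.exp (-(h*D/2))) := by gcongr
    nlinarith
  suffices hl : ∃ l, 0 ≤ l ∧ l ≤ s ∧ l ≤ D ∧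
      3*κ*Real.exp (-(h*D/2)) < Real.exp (-(h*l)) * (l*cB/s) by
    obtain ⟨l, hl0, hls, hlD, hl⟩ := hl
    rw [Ioi_split _ (show h*s^2 ≤ h*s^2+D by linarith)]
    have h5 := gs_win hs0 hh0.le hl0 hls
    have h6 : (gs 0 s).real (Ioc (h*s^2) (h*s^2+l)) ≤ (gs 0 s).real (Ioc (h*s^2) (h*s^2+D)) :=
      measureReal_mono (Ioc_subset_Ioc_right (by linarith))
    have h7 : g * (3*κ*Real.exp (-(h*D/2))) < g * (Real.exp (-(h*l)) * (l*cB/s)) := by gcongr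
    nlinarith
  have h8 : 3*κ*s*2 < D*cB := by
    have : (3*κ*s*2)*C < (D*cB)*C := by
      calc _ = (6*C₁)*D := by linear_combination 6*hκD
        _ < (C*cB)*D := by gcongr
        _ = _ := by ring
    exact lt_of_mul_lt_mul_right this (by linarith)
  by_cases hc : D/2 ≤ s
  · refine ⟨D/2, by linarith, hc, by linarith, ?_⟩
    rw [mul_comm, show h*(D/2) = h*D/2 by ring]
    gcongr
    rw [lt_div_iff₀ hs0]
    linarith
  · push Not at hc
    have hsh : 1 < s*h := by
      by_contra hcon
      push Not at hcon
      have : (s*h)^2 ≤ 1 := by rw [sq_le_one_iff₀ (by positivity)]; exact hcon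
      have : D ≤ C*2 := by rw [hD]; gcongr; nlinarith
      linarith
    have h9 : 1/h ≤ s := by rw [div_le_iff₀ hh0]; linarith
    refine ⟨1/h, by positivity, h9, by linarith, ?_⟩
    have h10 : (h*D/2) * Real.exp (-(h*D/2)) ≤ Real.exp (-1) := by
      have := Real.add_one_le_exp (h*D/2-1)
      have h11 : Real.exp (-1) = Real.exp (h*D/2-1) * Real.exp (-(h*D/2)) := by
        rw [← Real.exp_add]; congr 1; ring
      rw [h11]; gcongr; linarith
    rw [mul_one_div_cancel hh0.ne']
    set E := Real.exp (-(h*D/2)) with hE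
    have hE0 : 0 < E := Real.exp_pos _
    rw [show Real.exp (-1) * (1/h*cB/s) = Real.exp (-1) * cB / (h*s) by field_simp,
      lt_div_iff₀ (by positivity)]
    calc _ = (3*κ*s*2) * (h/2*E) := by ring
      _ < (D*cB) * (h/2*E) := by gcongr
      _ = (h*D/2*E)*cB := by ring
      _ ≤ _ := by gcongr

set_option maxHeartbeats 2000000 in
lemma lower1 {C₁ C : ℝ} (hC₁ : 1 ≤ C₁) (hK : KS C₁) (hC1 : 1 ≤ C) (hC : 16*C₁ ≤ C*cB)
    {F : Measure ℝ} [IsProbabilityMeasure F] {s : ℝ} (hs : C ≤ s) (hF : Good F s) {h : ℝ}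
    (hh0 : 0 < h) (hh : h ≤ 1/2) (hB : C*(1+s^2*h^2) ≤ 24*s) :
    (gs 0 s).real (Ioi (h*s^2)) < F.real (Ioi (h*s^2 - C*(1+s^2*h^2))) := by
  have hs0 : 0 < s := by linarith
  have hcB := cB_pos
  set D := C*(1+s^2*h^2) with hD
  set g := Real.exp (-(s^2*h^2/2)) with hg
  have hg0 : 0 < g := Real.exp_pos _
  have hsh0 : 0 ≤ s^2*h^2 := by positivity
  have hD0 : 0 < D := by positivity
  have hDsh : s^2*h^2 ≤ D := by nlinarith
  set κ := C₁*(1/s+s*h^2) with hκ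
  have hκD : κ * s * C = C₁ * D := by rw [hκ, hD]; field_simp
  have hκ0 : 0 < κ := by positivity
  have hκ1 : s*h^2 ≤ κ := by
    have : 0 < 1/s := by positivity
    have : 0 ≤ s*h^2 := by positivity
    nlinarith
  set e := s^2*h^3/2 with he
  have he0 : 0 ≤ e := by positivity
  have heD : e ≤ h*D/2 := by
    have : h*(s^2*h^2) ≤ h*D := by gcongr
    have : e = h*(s^2*h^2)/2 := by rw [he]; ring
    linarith
  have hab : |h| < 1 := by rw [abs_of_pos hh0]; linarith
  have hlam := abs_le.1 (hF.lam_bound hab)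
  rw [abs_of_pos hh0] at hlam
  set v := h*s^2 - D/2 with hv
  have hm := (abs_le.1 (main_ineq hK hs0 hF hh0 hh v)).1
  set q := (gs 0 s).real (Ioi (h*s^2)) with hq
  have hq0 : 0 ≤ q := measureReal_nonneg
  have hqv : q ≤ (gs 0 s).real (Ioi v) := measureReal_mono (Ioi_subset_Ioi (by linarith))
  have hprob := hF.prob hab
  rw [Ioi_split F (show h*s^2 - D ≤ v by linarith)]
  -- window
  have hwin : 8*κ ≤ (gs (h*s^2) s).real (Ioc (h*s^2-D) v) := by
    refine le_trans ?_ (gs_win2 hs0 (by linarith) (by linarith) (by linarith))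
    rw [le_div_iff₀ hs0]
    have : (8*κ*s)*C ≤ ((v - (h*s^2-D))*cB)*C := by
      calc _ = (16*C₁)*(D/2) := by linear_combination 8*hκD
        _ ≤ (C*cB)*(D/2) := by gcongr
        _ = _ := by rw [hv]; ring
    exact le_of_mul_le_mul_right this (by linarith)
  have hks : 6*κ ≤ (Fh F h).real (Ioc (h*s^2-D) v) := by
    have hle : h*s^2-D ≤ v := by linarith
    rw [← real_Iic_sub _ hle] at hwin ⊢
    have a1 := abs_le.1 (hK F s ‹_› hs0 hF h (by rw [abs_of_pos hh0]; linarith) v)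
    have a2 := abs_le.1 (hK F s ‹_› hs0 hF h (by rw [abs_of_pos hh0]; linarith) (h*s^2-D))
    linarith [a1.1, a1.2, a2.1, a2.2]
  have hwF : 6*κ*Real.exp (-h*v) ≤ Real.exp (-lam F h) * F.real (Ioc (h*s^2-D) v) := by
    rw [← hF.tilt_set hab]
    calc _ ≤ (Fh F h).real (Ioc (h*s^2-D) v) * Real.exp (-h*v) := by gcongr
      _ = ∫ u in Ioc (h*s^2-D) v, Real.exp (-h*v) ∂(Fh F h) := by simp
      _ ≤ _ := by
        refine setIntegral_mono_on (by simp) ?_ measurableSet_Ioc ?_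
        · refine Continuous.integrableOn_Ioc (by fun_prop)
        · intro u hu
          apply Real.exp_le_exp.2
          nlinarith [hu.2]
  set P := F.real (Ioc (h*s^2-D) v) + F.real (Ioi v) with hP
  have h1 : g * q + 4*κ*Real.exp (-h*v) ≤ Real.exp (-lam F h) * P := by
    have : g * q ≤ g * (gs 0 s).real (Ioi v) := by gcongr
    rw [hP, mul_add]; linarith
  have h2 : q + 4*κ*g*Real.exp (h*D/2) ≤ Real.exp e * P := by
    have a1 : Real.exp (s^2*h^2/2) * g = 1 := by rw [hg, ← Real.exp_add]; simp
    have a2 : Real.exp (s^2*h^2/2) * Real.exp (-h*v) = g * Real.exp (h*D/2) := by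
      rw [hg, ← Real.exp_add, ← Real.exp_add, hv]; congr 1; ring
    have a3 : Real.exp (s^2*h^2/2) * Real.exp (-lam F h) ≤ Real.exp e := by
      rw [← Real.exp_add]; apply Real.exp_le_exp.2; linarith
    have hP0 : 0 ≤ P := by positivity
    calc _ = (Real.exp (s^2*h^2/2) * g) * q + 4*κ*(g * Real.exp (h*D/2)) := by rw [a1]; ring
      _ = Real.exp (s^2*h^2/2) * (g * q + 4*κ*Real.exp (-h*v)) := by rw [← a2]; ring
      _ ≤ Real.exp (s^2*h^2/2) * (Real.exp (-lam F h) * P) := by gcongr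
      _ = (Real.exp (s^2*h^2/2) * Real.exp (-lam F h)) * P := by ring
      _ ≤ _ := by gcongr
  have h3 : (Real.exp e - 1) * q < 4*κ*g*Real.exp (h*D/2) := by
    have a1 := gs_tail (r := 0) hs0 hh0
    simp only [add_zero, mul_zero, neg_zero, Real.exp_zero, mul_one] at a1
    have a2 := exp_sub_one_le e
    calc _ ≤ (e * Real.exp e) * (g / (2*s*h)) := by gcongr
      _ = (s*h^2/4) * g * Real.exp e := by rw [he]; field_simp; ring
      _ ≤ κ * g * Real.exp (h*D/2) := by
        have : 0 ≤ s*h^2 := by positivity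
        gcongr; linarith
      _ < _ := by
        have : 0 < κ * g * Real.exp (h*D/2) := by positivity
        linarith
  have h4 : Real.exp e * q < Real.exp e * P := by linarith
  exact lt_of_mul_lt_mul_left h4 (Real.exp_pos _).le

set_option maxHeartbeats 2000000 in
lemma lower2 {C : ℝ} (hC : 8 ≤ C)
    {F : Measure ℝ} [IsProbabilityMeasure F] {s : ℝ} (hs : 3*C ≤ s) (hF : Good F s) {h : ℝ}
    (hh0 : 0 < h) (hh : h ≤ 1/(3*C)) (hB : 24*s < C*(1+s^2*h^2)) :
    (gs 0 s).real (Ioi (h*s^2)) < F.real (Ioi (h*s^2 - C*(1+s^2*h^2))) := by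
  have hs0 : 0 < s := by linarith
  have hCh : C*h ≤ 1/3 := by
    rw [le_div_iff₀ (by linarith)] at hh; linarith
  have hsh : 1 < s*h := by
    by_contra hcon
    push Not at hcon
    have : (s*h)^2 ≤ 1 := by rw [sq_le_one_iff₀ (by positivity)]; exact hcon
    have : C*(1+s^2*h^2) ≤ C*2 := by gcongr; nlinarith
    linarith
  set D := C*(1+s^2*h^2) with hD
  have hD0 : 0 < D := by positivity
  set g := Real.exp (-(s^2*h^2/2)) with hg
  have hg0 : 0 < g := Real.exp_pos _
  have hDh : D ≤ 2/3*(s^2*h) := by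
    have a1 : C*(s^2*h^2) ≤ 1/3*(s^2*h) := by
      calc _ = (C*h)*(s^2*h) := by ring
        _ ≤ _ := by gcongr
    have a2 : C ≤ 1/3*(s^2*h) := by nlinarith
    rw [hD]; linarith
  set k := h - 3*D/(4*s^2) with hk
  have hkD : (h-k)*s^2 = 3*D/4 := by rw [hk]; field_simp; ring
  have hkh : k ≤ h := by
    have : 0 ≤ 3*D/(4*s^2) := by positivity
    linarith
  have hk2 : h/2 ≤ k := by
    have : 3*D/(4*s^2) ≤ h/2 := by rw [div_le_iff₀ (by positivity)]; linarith
    linarith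
  have hk0 : 0 < k := by linarith
  set u := h*s^2 - D with hu
  set v := h*s^2 - D/2 with hv
  have hu' : u = k*s^2 - D/4 := by linarith
  have hv' : v = k*s^2 + D/4 := by linarith
  have hs24 : 24 ≤ s := by linarith
  have hh24 : h ≤ 1/24 := by nlinarith
  have hds : 1/s ≤ 1/24 := one_div_le_one_div_of_le (by norm_num) hs24
  have hds0 : 0 < 1/s := by positivity
  have hds1 : s*(1/s) = 1 := by field_simp
  set d := 1/s with hd
  have hsd : s^2*d = s := by rw [hd]; field_simp
  have hr1 : k + d < 1 := by linarith
  -- bound for exponent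
  have hexp : 1/2 + s*(k+d)^2/2 - d*D/4 ≤ -(3/2) := by
    have a1 : s*(k+d)^2 ≤ 2*(s*h^2) + 2*d := by
      have : (k+d)^2 ≤ 2*h^2+2*d^2 := by nlinarith [sq_nonneg (h-d)]
      calc _ ≤ s*(2*h^2+2*d^2) := by gcongr
        _ = 2*(s*h^2) + 2*(s*d)*d := by ring
        _ = _ := by rw [hds1]; ring
    have a2 : s*h^2*8 ≤ d*D := by
      have : (s*h^2*8)*s ≤ (d*D)*s := by
        calc _ = 8*(s^2*h^2) := by ring
          _ ≤ C*(1+s^2*h^2) := by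
            have : 0 ≤ s^2*h^2 := by positivity
            nlinarith
          _ = (s*d)*D := by rw [hds1]; ring
          _ = _ := by ring
      exact le_of_mul_le_mul_right this hs0
    have a3 : 24 ≤ d*D := by
      have : 24*s*d ≤ D*d := by gcongr
      nlinarith
    linarith
  have hq : Real.exp (-(3/2)) ≤ 1/4 := by
    have : (4:ℝ) ≤ Real.exp (3/2) := by
      have h1 := Real.quadratic_le_exp_of_nonneg (x := 3/2) (by norm_num)
      have h2 := Real.exp_one_gt_d9
      have h3 : Real.exp (3/2) = Real.exp 1 * Real.exp (1/2) := by rw [← Real.exp_add]; norm_num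
      have h4 := Real.quadratic_le_exp_of_nonneg (x := 1/2) (by norm_num)
      rw [h3]; nlinarith
    rw [Real.exp_neg, one_div]
    exact inv_anti₀ (by norm_num) this
  have hab : |k| < 1 := by rw [abs_of_pos hk0]; linarith
  have hkd1 : |k+d| ≤ k+d := by rw [abs_of_pos (by linarith)]
  have hkd2 : |k-d| ≤ k+d := by rw [abs_le]; constructor <;> linarith
  have hkd3 : |k| ≤ k+d := by rw [abs_of_pos hk0]; linarith
  have l1 : -d*v + lam F (k+d) ≤ lam F k - 3/2 := by
    have := (abs_le.1 (hF.lam_diff hr1 hkd1 hkd3)).2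
    rw [show k+d-k = d by ring, abs_of_pos hds0] at this
    have e1 : s^2*((k+d)^2-k^2)/2 = s*k + (s*d)/2 := by
      linear_combination (k + d/2)*hsd
    have e2 : s^2/2*(k+d)^2*d = s*(k+d)^2/2 := by linear_combination ((k+d)^2/2)*hsd
    have e3 : d*v = s*k + d*D/4 := by rw [hv']; linear_combination k*hsd
    rw [e1, e2, hds1] at this
    linarith
  have l2 : d*u + lam F (k-d) ≤ lam F k - 3/2 := by
    have := (abs_le.1 (hF.lam_diff hr1 hkd2 hkd3)).2
    rw [show k-d-k = -d by ring, abs_neg, abs_of_pos hds0] at this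
    have e1 : s^2*((k-d)^2-k^2)/2 = -s*k + (s*d)/2 := by
      linear_combination (-k + d/2)*hsd
    have e2 : s^2/2*(k+d)^2*d = s*(k+d)^2/2 := by linear_combination ((k+d)^2/2)*hsd
    have e3 : d*u = s*k - d*D/4 := by rw [hu']; linear_combination k*hsd
    rw [e1, e2, hds1] at this
    linarith
  have i0 := hF.integrable hab
  have i1 := hF.integrable (hkd1.trans_lt hr1)
  have i2 := hF.integrable (hkd2.trans_lt hr1)
  have i3 : Integrable (fun x => Real.exp (k*x) - Real.exp (d*u) * Real.exp ((k-d)*x)) F :=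
    i0.sub (i2.const_mul _)
  -- Markov
  have hM : Real.exp (-k*v) * (Real.exp (lam F k) - Real.exp (d*u) * Real.exp (lam F (k-d))
      - Real.exp (-d*v) * Real.exp (lam F (k+d))) ≤ F.real (Ioc u v) := by
    rw [← hF.exp_lam hab, ← hF.exp_lam (hkd1.trans_lt hr1), ← hF.exp_lam (hkd2.trans_lt hr1),
      ← integral_const_mul, ← integral_const_mul, ← integral_sub i0 (i2.const_mul _),
      ← integral_sub i3 (i1.const_mul _), ← integral_const_mul,
      ← integral_indicator_one measurableSet_Ioc]
    refine integral_mono ((i3.sub (i1.const_mul _)).const_mul _)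
      ((integrable_const (1:ℝ)).indicator measurableSet_Ioc) fun x => ?_
    have e : Real.exp (-k*v) * (Real.exp (k*x) - Real.exp (d*u) * Real.exp ((k-d)*x)
      - Real.exp (-d*v) * Real.exp ((k+d)*x)) = Real.exp (k*(x-v)) *
        (1 - Real.exp (d*(u-x)) - Real.exp (d*(x-v))) := by
      simp only [mul_sub, mul_one, ← Real.exp_add]
      congr 1
      · congr 1
        · congr 1; ring
        · congr 1; ring
      · congr 1; ring
    show Real.exp (-k*v) * (Real.exp (k*x) - Real.exp (d*u) * Real.exp ((k-d)*x)
      - Real.exp (-d*v) * Real.exp ((k+d)*x)) ≤ _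
    rw [e]
    have p1 := Real.exp_pos (k*(x-v))
    have p2 := Real.exp_pos (d*(u-x))
    have p3 := Real.exp_pos (d*(x-v))
    by_cases hx : x ∈ Ioc u v
    · rw [indicator_of_mem hx]
      have : Real.exp (k*(x-v)) ≤ 1 := by
        rw [Real.exp_le_one_iff]; nlinarith [hx.2]
      simp only [Pi.one_apply]
      nlinarith
    · rw [indicator_of_notMem hx]
      have : 1 ≤ Real.exp (d*(u-x)) ∨ 1 ≤ Real.exp (d*(x-v)) := by
        rw [Real.one_le_exp_iff, Real.one_le_exp_iff]
        by_cases hxu : u < x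
        · right
          have : v < x := by by_contra hcon; exact hx ⟨hxu, not_lt.1 hcon⟩
          exact mul_nonneg hds0.le (by linarith)
        · left
          exact mul_nonneg hds0.le (by linarith)
      apply mul_nonpos_of_nonneg_of_nonpos p1.le
      rcases this with h | h <;> linarith
  have hM2 : 1/2 * Real.exp (lam F k - k*v) ≤ F.real (Ioc u v) := by
    refine le_trans ?_ hM
    have a0 : Real.exp (lam F k - 3/2) ≤ 1/4 * Real.exp (lam F k) := by
      rw [show lam F k - 3/2 = -(3/2) + lam F k by ring, Real.exp_add]; gcongr
    have a1 := Real.exp_le_exp.2 l1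
    have a2 := Real.exp_le_exp.2 l2
    rw [Real.exp_add] at a1 a2
    rw [show lam F k - k*v = -k*v + lam F k by ring, Real.exp_add]
    have p := Real.exp_pos (-k*v)
    nlinarith
  have hlam := (abs_le.1 (hF.lam_bound hab)).1
  rw [abs_of_pos hk0] at hlam
  have hfin : -(s^2*h^2/2) ≤ lam F k - k*v := by
    have a1 : s^2*h^2/2 - s^2*k^2/2 = (3*D/8)*(h+k) := by
      linear_combination (h+k)/2*hkD
    have a2 : k*v = s^2*k^2 + k*D/4 := by rw [hv']; ring
    have a3 : s^2*k^3/2 ≤ k*D/16 := by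
      have : s^2*k^2*8 ≤ D := by
        calc _ ≤ s^2*h^2*8 := by gcongr
          _ ≤ C*(1+s^2*h^2) := by
            have : 0 ≤ s^2*h^2 := by positivity
            nlinarith
      nlinarith
    have a4 : D*k ≤ D*h := by gcongr
    nlinarith [mul_pos hD0 hk0]
  calc _ ≤ g / (2*s*h) := by
        have a1 := gs_tail (r := 0) hs0 hh0
        simpa only [add_zero, mul_zero, neg_zero, Real.exp_zero, mul_one] using a1
    _ < 1/2 * g := by
        rw [div_lt_iff₀ (by positivity)]; nlinarith
    _ ≤ 1/2 * Real.exp (lam F k - k*v) := by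
        have := Real.exp_le_exp.2 hfin
        linarith
    _ ≤ F.real (Ioc u v) := hM2
    _ ≤ _ := measureReal_mono Ioc_subset_Ioi_self

lemma tails : ∃ C : ℝ, 1 ≤ C ∧ ∀ (F : Measure ℝ) (s : ℝ), IsProbabilityMeasure F → 3*C ≤ s →
    Good F s → ∀ h : ℝ, 0 < h → h ≤ 1/(3*C) →
      F.real (Ioi (h*s^2 + C*(1+s^2*h^2))) < (gs 0 s).real (Ioi (h*s^2)) ∧
      (gs 0 s).real (Ioi (h*s^2)) < F.real (Ioi (h*s^2 - C*(1+s^2*h^2))) := by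
  obtain ⟨C₁, hC₁, hK⟩ := ks_tilted
  have hc := cB_pos
  have hc2 := cB_le
  refine ⟨16*C₁/cB, ?_, ?_⟩
  · rw [le_div_iff₀ hc]; linarith
  have h8 : 8 ≤ 16*C₁/cB := by rw [le_div_iff₀ hc]; linarith
  have hCc : 16*C₁/cB*cB = 16*C₁ := by field_simp
  intro F s _ hs hF h hh0 hh
  set C := 16*C₁/cB
  have hh2 : h ≤ 1/2 := hh.trans (one_div_le_one_div_of_le (by norm_num) (by linarith))
  refine ⟨upper hC₁ hK (by linarith) (by linarith) (by linarith) hF hh0 hh2, ?_⟩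
  by_cases hB : C*(1+s^2*h^2) ≤ 24*s
  · exact lower1 hC₁ hK (by linarith) (by linarith) (by linarith) hF hh0 hh2 hB
  · exact lower2 h8 hs hF hh0 hh (not_le.1 hB)
end OW

namespace OW
open Set Filter Topology

lemma gs_Ioc_pos {s a b : ℝ} (hs : 0 < s) (hab : a < b) : 0 < (gs 0 s).real (Ioc a b) := by
  refine lt_of_lt_of_le ?_ (gs_Ioc_ge
    (c := (√(2*Real.pi))⁻¹/s*Real.exp (-(|a|+|b|)^2/(2*s^2))) hs hab.le ?_)
  · have : 0 < b - a := by linarith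
    positivity
  · intro x hx
    rw [pdf_eq hs]
    have h1 : |x - 0| ≤ |a|+|b| := by
      rw [sub_zero, abs_le]
      have := neg_abs_le a
      have := le_abs_self b
      have := abs_nonneg a
      have := abs_nonneg b
      constructor <;> linarith [hx.1, hx.2]
    gcongr ?_ * Real.exp (-?_ / _)
    exact sq_le_sq' (by linarith [abs_le.1 h1]) (by linarith [abs_le.1 h1])

lemma gs_strictMono {s : ℝ} (hs : 0 < s) : StrictMono (fun y => (gs 0 s).real (Iic y)) := by
  intro a b hab
  have := gs_Ioc_pos hs hab
  rw [← real_Iic_sub _ hab.le] at this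
  show (gs 0 s).real (Iic a) < (gs 0 s).real (Iic b)
  linarith

lemma gs_cont {s : ℝ} (hs : 0 < s) : Continuous (fun y => (gs 0 s).real (Iic y)) := by
  have : LipschitzWith (1/s).toNNReal (fun y => (gs 0 s).real (Iic y)) := by
    apply LipschitzWith.of_le_add_mul
    intro x y
    rw [Real.coe_toNNReal _ (by positivity), Real.dist_eq]
    rcases le_total x y with h | h
    · have h1 := (gs_strictMono hs).monotone h
      have : 0 ≤ 1/s*|x-y| := by positivity
      exact h1.trans (by linarith)
    · have := gs_lip (m := 0) hs h
      rw [abs_of_nonneg (by linarith)]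
      linarith
  exact this.continuous

lemma Ioi_eq (μ : Measure ℝ) [IsProbabilityMeasure μ] (a : ℝ) :
    μ.real (Ioi a) = 1 - μ.real (Iic a) := by
  rw [← compl_Iic, probReal_compl_eq_one_sub measurableSet_Iic]

lemma gs_pos {s : ℝ} (hs : 0 < s) (y : ℝ) : 0 < (gs 0 s).real (Iic y) :=
  (gs_Ioc_pos hs (show y-1<y by linarith)).trans_le (measureReal_mono Ioc_subset_Iic_self)

lemma gs_lt_one {s : ℝ} (hs : 0 < s) (y : ℝ) : (gs 0 s).real (Iic y) < 1 := by
  have := (gs_Ioc_pos hs (show y<y+1 by linarith)).trans_le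
    (measureReal_mono (μ := gs 0 s) (Ioc_subset_Ioi_self))
  rw [Ioi_eq] at this
  linarith

/-- Quantile transform. -/
def qt (F : Measure ℝ) (s y : ℝ) : ℝ := sInf {x | (gs 0 s).real (Iic y) ≤ F.real (Iic x)}

lemma qt_le_iff (F : Measure ℝ) [IsProbabilityMeasure F] {s : ℝ} (hs : 0 < s) (y x : ℝ) :
    qt F s y ≤ x ↔ (gs 0 s).real (Iic y) ≤ F.real (Iic x) := by
  set p := (gs 0 s).real (Iic y) with hp
  have hp0 : 0 < p := gs_pos hs y
  have hp1 : p < 1 := gs_lt_one hs y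
  have hmono : Monotone (fun x => F.real (Iic x)) := fun a b hab =>
    measureReal_mono (Iic_subset_Iic.2 hab)
  have hcdf : ∀ x, cdf F x = F.real (Iic x) := fun x => cdf_eq_real F x
  have hne : {x | p ≤ F.real (Iic x)}.Nonempty := by
    have := (tendsto_cdf_atTop F).eventually (lt_mem_nhds hp1)
    obtain ⟨x, hx⟩ := this.exists
    exact ⟨x, by rw [hcdf] at hx; exact hx.le⟩
  have hbd : BddBelow {x | p ≤ F.real (Iic x)} := by
    have := (tendsto_cdf_atBot F).eventually (gt_mem_nhds hp0)
    obtain ⟨a, ha⟩ := this.exists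
    refine ⟨a, fun x hx => ?_⟩
    by_contra hcon
    have h1 : F.real (Iic x) ≤ F.real (Iic a) := hmono (not_le.1 hcon).le
    rw [hcdf] at ha
    have h2 : p ≤ F.real (Iic x) := hx
    linarith
  constructor
  · intro h
    have hr : Tendsto (cdf F) (𝓝[>] x) (𝓝 (cdf F x)) :=
      ((cdf F).right_continuous x).tendsto.mono_left (nhdsWithin_mono _ Ioi_subset_Ici_self)
    rw [hcdf] at hr
    refine ge_of_tendsto hr ?_
    filter_upwards [self_mem_nhdsWithin] with z hz
    have hz2 : qt F s y < z := lt_of_le_of_lt h hz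
    obtain ⟨w, hw, hwz⟩ := exists_lt_of_csInf_lt hne hz2
    rw [hcdf]
    exact le_trans hw (hmono hwz.le)
  · intro h
    exact csInf_le hbd h

lemma qt_mono (F : Measure ℝ) [IsProbabilityMeasure F] {s : ℝ} (hs : 0 < s) :
    Monotone (qt F s) := by
  intro a b hab
  rw [qt_le_iff F hs]
  exact ((gs_strictMono hs).monotone hab).trans ((qt_le_iff F hs b _).1 le_rfl)

lemma qt_map (F : Measure ℝ) [IsProbabilityMeasure F] {s : ℝ} (hs : 0 < s) :
    (gs 0 s).map (qt F s) = F := by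
  have hm := (qt_mono F hs).measurable
  have := Measure.isProbabilityMeasure_map (μ := gs 0 s) hm.aemeasurable
  refine Measure.ext_of_Iic _ _ fun x => ?_
  rw [← measureReal_eq_measureReal_iff, measureReal_def, Measure.map_apply hm measurableSet_Iic]
  have e : qt F s ⁻¹' Iic x = {y | (gs 0 s).real (Iic y) ≤ F.real (Iic x)} := by
    ext y; exact qt_le_iff F hs y x
  rw [e, ← measureReal_def]
  set p := F.real (Iic x) with hp
  have hp0 : 0 ≤ p := measureReal_nonneg
  have hp1 : p ≤ 1 := measureReal_le_one
  rcases hp0.eq_or_lt with h0 | h0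
  · have : {y | (gs 0 s).real (Iic y) ≤ p} = ∅ := by
      ext y; have := gs_pos hs y; simp [← h0, this]
    rw [this, ← h0]; simp
  rcases hp1.eq_or_lt with h1 | h1
  · have : {y | (gs 0 s).real (Iic y) ≤ p} = univ := by
      ext y; simp [h1]
    rw [this, h1]; simp
  obtain ⟨y0, hy0⟩ : ∃ y, (gs 0 s).real (Iic y) = p := by
    have t1 := tendsto_cdf_atTop (gs 0 s)
    have t2 := tendsto_cdf_atBot (gs 0 s)
    obtain ⟨b, hb⟩ := (t1.eventually (lt_mem_nhds h1)).exists
    obtain ⟨a, ha⟩ := (t2.eventually (gt_mem_nhds h0)).exists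
    rw [cdf_eq_real] at ha hb
    exact mem_range_of_exists_le_of_exists_ge (gs_cont hs) ⟨a, ha.le⟩ ⟨b, hb.le⟩
  have : {y | (gs 0 s).real (Iic y) ≤ p} = Iic y0 := by
    ext y
    show (gs 0 s).real (Iic y) ≤ p ↔ y ≤ y0
    rw [← hy0]
    exact (gs_strictMono hs).le_iff_le
  rw [this, hy0]

lemma gs_map_neg (s : ℝ) : (gs 0 s).map (fun x => -x) = gs 0 s := by
  have := gaussianReal_map_neg (μ := 0) (v := (s^2).toNNReal)
  rw [neg_zero] at this
  exact this

lemma real_map_neg (μ : Measure ℝ) (a : ℝ) :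
    (μ.map (fun x => -x)).real (Ioi a) = μ.real (Iio (-a)) := by
  rw [measureReal_def, Measure.map_apply measurable_neg measurableSet_Ioi, measureReal_def]
  congr 2
  ext x; simp

lemma gs_Iio {s : ℝ} (hs : 0 < s) (a : ℝ) : (gs 0 s).real (Iio a) = (gs 0 s).real (Iic a) := by
  have := nullSingletonClass_gaussianReal (μ := 0) (sq_toNNReal_ne hs)
  exact measureReal_congr (μ := gs 0 s) (Iio_ae_eq_Iic' (by
    unfold gs; exact measure_singleton a))

lemma transport : ∃ C : ℝ, 1 ≤ C ∧ ∀ (F : Measure ℝ) (s : ℝ), IsProbabilityMeasure F → 3*C ≤ s →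
    Good F s → ∃ T : ℝ → ℝ, Measurable T ∧ (gs 0 s).map T = F ∧
      ∀ y, y ≠ 0 → |y| ≤ s^2/(3*C) → |T y - y| ≤ C*(1+y^2/s^2) := by
  obtain ⟨C, hC, ht⟩ := tails
  refine ⟨C, hC, fun F s _ hs hF => ?_⟩
  have hs0 : 0 < s := by linarith
  refine ⟨qt F s, (qt_mono F hs0).measurable, qt_map F hs0, ?_⟩
  have key : ∀ (G : Measure ℝ), IsProbabilityMeasure G → Good G s → ∀ y, 0 < y → y ≤ s^2/(3*C) →
      G.real (Ioi (y + C*(1+y^2/s^2))) < (gs 0 s).real (Ioi y) ∧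
      (gs 0 s).real (Ioi y) < G.real (Ioi (y - C*(1+y^2/s^2))) := by
    intro G hG hGG y hy hy2
    have := ht G s hG hs hGG (y/s^2) (by positivity) (by
      rw [div_le_iff₀ (by positivity)]
      calc _ ≤ _ := hy2
        _ = _ := by ring)
    have e1 : y/s^2*s^2 = y := by field_simp
    have e2 : s^2*(y/s^2)^2 = y^2/s^2 := by field_simp
    rwa [e1, e2] at this
  intro y hy0 hy
  set D := C*(1+y^2/s^2) with hD
  rw [abs_le]
  rcases lt_or_gt_of_ne hy0 with hneg | hpos
  · have := Measure.isProbabilityMeasure_map (μ := F) (measurable_neg (G := ℝ)).aemeasurable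
    obtain ⟨k1, k2⟩ := key _ this hF.neg (-y) (by linarith) (by rwa [abs_of_neg hneg] at hy)
    rw [neg_sq, ← hD, ← gs_map_neg s, real_map_neg, real_map_neg, neg_neg, gs_Iio hs0] at k1 k2
    constructor
    · by_contra hcon
      push Not at hcon
      obtain ⟨x, hx1, hx2⟩ := exists_between (show qt F s y < y - D by linarith)
      have h1 := (qt_le_iff F hs0 y x).1 hx1.le
      have h2 : F.real (Iic x) ≤ F.real (Iio (-(-y + D))) :=
        measureReal_mono (fun z hz => by
          have h3 : z ≤ x := hz
          show z < -(-y + D)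
          linarith)
      linarith
    · have : qt F s y ≤ y + D := by
        rw [qt_le_iff F hs0]
        refine k2.le.trans (measureReal_mono fun z hz => ?_)
        have : z < -(-y - D) := hz
        show z ≤ y + D
        linarith
      linarith
  · obtain ⟨k1, k2⟩ := key F ‹_› hF y hpos (by rwa [abs_of_pos hpos] at hy)
    rw [← hD, Ioi_eq, Ioi_eq] at k1 k2
    constructor
    · by_contra hcon
      push Not at hcon
      have h1 := (qt_le_iff F hs0 y (y-D)).1 (by linarith)
      linarith
    · have : qt F s y ≤ y + D := by
        rw [qt_le_iff F hs0]
        linarith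
      linarith
end OW

namespace OW
open Set Filter Topology

lemma cgf_mem_interior {φ : ℂ → ℂ} {τ : ℝ} {F : Measure ℝ} (hτ : 0 < τ) (h : IsCGF φ τ F) :
    (0:ℝ) ∈ interior (integrableExpSet (id : ℝ → ℝ) F) := by
  rw [_root_.mem_interior]
  refine ⟨Ioo (-(1/τ)) (1/τ), ?_, isOpen_Ioo, ?_⟩
  · intro k hk
    have hk2 : ‖(k:ℂ)‖ * τ < 1 := by
      rw [Complex.norm_real, Real.norm_eq_abs, ← lt_div_iff₀ hτ]
      exact abs_lt.2 hk
    refine (h.2 k hk2).1.norm.congr (ae_of_all _ fun x => ?_)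
    simp only [Complex.norm_exp]
    simp
  · have : 0 < 1/τ := by positivity
    exact ⟨by linarith, this⟩

lemma cgf_derivs {φ : ℂ → ℂ} {τ : ℝ} {F : Measure ℝ} [IsProbabilityMeasure F] (hτ : 0 < τ)
    (h0 : ∫ x, x ∂F = 0) (h : IsCGF φ τ F) :
    deriv φ 0 = 0 ∧ deriv (deriv φ) 0 = (variance id F : ℝ) := by
  have hint := cgf_mem_interior hτ h
  have hU : {z : ℂ | ‖z‖ * τ < 1} ∈ 𝓝 (0:ℂ) := by
    apply IsOpen.mem_nhds
    · exact isOpen_lt (by fun_prop) (by fun_prop)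
    · simp
  have hev : ∀ᶠ z in 𝓝 (0:ℂ), complexMGF id F z = Complex.exp (φ z) := by
    filter_upwards [hU] with z hz
    rw [(h.2 z hz).2.1]; rfl
  have hev1 : ∀ᶠ z in 𝓝 (0:ℂ), deriv (complexMGF id F) z = Complex.exp (φ z) * deriv φ z := by
    filter_upwards [hev.eventually_nhds, hU] with z hz hzU
    have : complexMGF id F =ᶠ[𝓝 z] fun w => Complex.exp (φ w) := hz
    rw [this.deriv_eq]
    exact ((h.2 z hzU).2.2.1.differentiableAt.hasDerivAt.cexp).deriv
  have hz0 : ‖(0:ℂ)‖ * τ < 1 := by simp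
  have han := (h.2 0 hz0).2.2.1
  have d1 : deriv (complexMGF id F) 0 = 0 := by
    rw [(hasDerivAt_complexMGF (by simpa using hint)).deriv]
    simp only [id, zero_mul, Complex.exp_zero, mul_one]
    rw [integral_complex_ofReal, h0]; simp
  have d2 : deriv (deriv (complexMGF id F)) 0 = ((∫ x, x^2 ∂F : ℝ) : ℂ) := by
    have := iteratedDeriv_complexMGF (z := 0) (X := id) (μ := F) (by simpa using hint) 2
    rw [iteratedDeriv_succ, iteratedDeriv_one] at this
    rw [this, ← integral_complex_ofReal]
    simp
  have e1 := hev1.self_of_nhds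
  rw [d1, h.1, Complex.exp_zero, one_mul] at e1
  have e2 : deriv (complexMGF id F) =ᶠ[𝓝 0] fun z => Complex.exp (φ z) * deriv φ z := hev1
  rw [e2.deriv_eq] at d2
  have hd : HasDerivAt (fun z => Complex.exp (φ z) * deriv φ z)
    (Complex.exp (φ 0) * deriv φ 0 * deriv φ 0 + Complex.exp (φ 0) * deriv (deriv φ) 0) 0 :=
    han.differentiableAt.hasDerivAt.cexp.mul han.deriv.differentiableAt.hasDerivAt
  rw [hd.deriv, ← e1, h.1] at d2
  simp only [Complex.exp_zero, mul_zero, zero_add, one_mul] at d2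
  refine ⟨e1.symm, ?_⟩
  rw [d2]
  have hm : MemLp (id : ℝ → ℝ) 2 F := by
    exact_mod_cast memLp_of_mem_interior_integrableExpSet hint 2
  rw [variance_eq_sub hm]
  simp [h0]

lemma cgf_g {φ : ℂ → ℂ} {τ : ℝ} {F : Measure ℝ} [IsProbabilityMeasure F] (hτ : 0 < τ)
    (h0 : ∫ x, x ∂F = 0) (h : IsCGF φ τ F) {z : ℂ} (hz : ‖z‖ * τ < 1) :
    ‖deriv φ z - (variance id F : ℝ) * z‖ ≤ τ * variance id F * ‖z‖^2/2 := by
  obtain ⟨d1, d2⟩ := cgf_derivs hτ h0 h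
  set V : ℝ := variance id F with hV
  have hball : ∀ w : ℂ, w ∈ Metric.ball (0:ℂ) (1/τ) ↔ ‖w‖ * τ < 1 := fun w => by
    rw [mem_ball_zero_iff, lt_div_iff₀ hτ]
  have hf : ∀ w : ℂ, ‖w‖ * τ < 1 → ‖deriv (deriv φ) w - V‖ ≤ τ * V * ‖w‖ := by
    intro w hw
    have := (convex_ball (0:ℂ) (1/τ)).norm_image_sub_le_of_norm_deriv_le (𝕜 := ℂ)
      (f := deriv (deriv φ)) (C := τ*V) (x := 0) (y := w) ?_ ?_ ((hball _).2 (by simp)) ((hball _).2 hw)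
    · rw [d2, sub_zero] at this; exact this
    · intro x hx
      exact (h.2 x ((hball _).1 hx)).2.2.1.deriv.deriv.differentiableAt
    · intro x hx
      have := (h.2 x ((hball _).1 hx)).2.2.2
      rwa [iteratedDeriv_succ, iteratedDeriv_succ, iteratedDeriv_one] at this
  have hseg : ∀ t ∈ Icc (0:ℝ) 1, ‖(t:ℂ)*z‖ * τ < 1 := by
    intro t ht
    rw [norm_mul, Complex.norm_real, Real.norm_of_nonneg ht.1]
    have := norm_nonneg z
    calc _ ≤ 1 * ‖z‖ * τ := by gcongr; exact ht.2
      _ < 1 := by rwa [one_mul]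
  have hd : ∀ t ∈ Icc (0:ℝ) 1, HasDerivAt (fun t : ℝ => deriv φ (t*z) - V * (t*z))
      (z * (deriv (deriv φ) (t*z) - V)) t := by
    intro t ht
    have a1 : HasDerivAt (fun t : ℝ => (t:ℂ)*z) z t := by
      simpa using (Complex.ofRealCLM.hasDerivAt (x := t)).mul_const z
    have a2 := (h.2 _ (hseg t ht)).2.2.1.deriv.differentiableAt.hasDerivAt
    have a3 : HasDerivAt (fun w : ℂ => deriv φ w - V * w) (deriv (deriv φ) (t*z) - V) (t*z) := by
      have := a2.sub ((hasDerivAt_id (t*z : ℂ)).const_mul (V:ℂ))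
      exact this.congr_deriv (by simp)
    have := HasDerivAt.comp t a3 a1
    rw [mul_comm] at this
    exact this
  have := image_norm_le_of_norm_deriv_right_le_deriv_boundary (a := 0) (b := 1)
    (f := fun t : ℝ => deriv φ (t*z) - V * (t*z))
    (f' := fun t : ℝ => z * (deriv (deriv φ) (t*z) - V))
    (B := fun t : ℝ => τ*V*‖z‖^2/2 * t^2) (B' := fun t : ℝ => τ*V*‖z‖^2/2*(2*t))
    (fun t ht => (hd t ht).continuousAt.continuousWithinAt)
    (fun t ht => (hd t (Ico_subset_Icc_self ht)).hasDerivWithinAt)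
    (by simp [d1]) (fun t => by simpa using (hasDerivAt_pow 2 t).const_mul (τ*V*‖z‖^2/2)) ?_
    (right_mem_Icc.2 zero_le_one)
  · simpa using this
  · intro t ht
    have ht' := Ico_subset_Icc_self ht
    have := hf _ (hseg t ht')
    rw [norm_mul, Complex.norm_real, Real.norm_of_nonneg ht.1] at this
    rw [norm_mul]
    calc _ ≤ ‖z‖ * (τ*V*(t*‖z‖)) := by gcongr
      _ = _ := by ring

lemma good_of_A1 {τ : ℝ} {F : Measure ℝ} [IsProbabilityMeasure F] (hτ : 0 < τ)
    (h0 : ∫ x, x ∂F = 0) (hA : MemA1 τ F) : Good (F.map (fun x => x/τ)) (√(variance id F)/τ) := by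
  obtain ⟨φ, h⟩ := hA
  set V : ℝ := variance id F with hV
  have hV0 : 0 ≤ V := variance_nonneg _ _
  have hs2 : (√V/τ)^2 = V/τ^2 := by rw [div_pow, Real.sq_sqrt hV0]
  have hs2' : (((√V/τ : ℝ)) : ℂ)^2 = V/τ^2 := by rw [← Complex.ofReal_pow, hs2]; push_cast; rfl
  have hτc : (τ:ℂ) ≠ 0 := by exact_mod_cast hτ.ne'
  have hn : ∀ z : ℂ, ‖z/τ‖ * τ = ‖z‖ := fun z => by
    rw [norm_div, Complex.norm_real, Real.norm_of_nonneg hτ.le]; field_simp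
  refine ⟨fun z => φ (z/τ) - V/τ^2*z^2/2, by simp [h.1], ?_, ?_⟩
  · intro z hz
    obtain ⟨i1, i2, -, -⟩ := h.2 (z/τ) (by rwa [hn])
    have hm : AEMeasurable (fun x : ℝ => x/τ) F := by fun_prop
    have hc : ∀ μ : Measure ℝ, AEStronglyMeasurable (fun x : ℝ => Complex.exp (z * x)) μ :=
      fun μ => Continuous.aestronglyMeasurable (by fun_prop)
    rw [integrable_map_measure (hc _) hm, integral_map hm (hc _)]
    have e : ∀ x : ℝ, z * ((x/τ : ℝ) : ℂ) = z/τ*x := fun x => by push_cast; ring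
    constructor
    · refine i1.congr (ae_of_all _ fun x => ?_)
      simp only [Function.comp, e]
    · simp only [e]
      rw [← i2, hs2']; congr 1; ring
  · intro z w r hr hz hw
    have := (convex_closedBall (0:ℂ) r).norm_image_sub_le_of_norm_hasDerivWithin_le (𝕜 := ℂ)
      (f := fun z : ℂ => φ (z/τ) - V/τ^2*z^2/2)
      (f' := fun z : ℂ => (deriv φ (z/τ) - V * (z/τ))/τ) (C := (√V/τ)^2/2*r^2)
      (x := w) (y := z) ?_ ?_ (by simpa using hw) (by simpa using hz)
    · exact this
    · intro x hx
      have hx1 : ‖x‖ ≤ r := by simpa using hx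
      have a1 : HasDerivAt (fun z : ℂ => z/τ) (1/τ) x := (hasDerivAt_id x).div_const _
      have a2 := (h.2 (x/τ) (by rw [hn]; linarith)).2.2.1.differentiableAt.hasDerivAt
      have a3 := HasDerivAt.comp x a2 a1
      have a4 : HasDerivAt (fun z : ℂ => V/τ^2*z^2/2) (V/τ^2*x) x := by
        have := ((hasDerivAt_pow 2 x).const_mul ((V:ℂ)/τ^2)).div_const 2
        refine this.congr_deriv ?_
        push_cast; ring
      refine HasDerivAt.hasDerivWithinAt ((a3.sub a4).congr_deriv ?_)
      field_simp
    · intro x hx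
      have hx1 : ‖x‖ ≤ r := by simpa using hx
      have := cgf_g hτ h0 h (z := x/τ) (by rw [hn]; linarith)
      rw [norm_div, Complex.norm_real, Real.norm_of_nonneg hτ.le, hs2, div_le_iff₀ hτ]
      refine this.trans ?_
      rw [norm_div, Complex.norm_real, Real.norm_of_nonneg hτ.le]
      calc _ = V/τ^2/2*‖x‖^2*τ := by rw [← hV]; field_simp
        _ ≤ _ := by gcongr
end OW

namespace OW
open Set Filter Topology

lemma good_gs (s : ℝ) : Good (gs 0 s) s := by
  refine ⟨fun _ => 0, rfl, ?_, ?_⟩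
  · intro z hz
    constructor
    · have h1 : Integrable (fun x => Real.exp (z.re * x)) (gs 0 s) :=
        integrable_exp_mul_gaussianReal z.re
      refine h1.mono (Continuous.aestronglyMeasurable (by fun_prop)) (ae_of_all _ fun x => ?_)
      rw [Complex.norm_exp]; simp
    · have := complexMGF_id_gaussianReal (μ := 0) (v := (s^2).toNNReal) z
      rw [show ∫ x : ℝ, Complex.exp (z*x) ∂(gs 0 s) = complexMGF id (gs 0 s) z from rfl, gs, this]
      have e : (((s^2).toNNReal : ℝ) : ℂ) = (s:ℂ)^2 := by rw [coe_sq]; push_cast; rfl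
      simp only [e, add_zero]
      congr 1
      simp
  · intro z w r _ _ _
    simp only [sub_self, norm_zero]; positivity

lemma exp_abs_le (t x : ℝ) : Real.exp (t*|x|) ≤ Real.exp (t*x) + Real.exp (-t*x) := by
  have := Real.exp_pos (t*x)
  have := Real.exp_pos (-t*x)
  rcases abs_cases x with ⟨h, _⟩ | ⟨h, _⟩
  · rw [h]; linarith
  · rw [h, show t * -x = -t*x by ring]; linarith

lemma Good.exp_abs {F : Measure ℝ} [IsProbabilityMeasure F] {s : ℝ} (hF : Good F s) {t : ℝ}
    (ht0 : 0 ≤ t) (ht : t < 1) : Integrable (fun x => Real.exp (t*|x|)) F ∧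
      ∫ x, Real.exp (t*|x|) ∂F ≤ 2*Real.exp (s^2*t^2) := by
  have a1 : |t| < 1 := by rwa [abs_of_nonneg ht0]
  have a2 : |-t| < 1 := by rwa [abs_neg]
  have i1 := hF.integrable a1
  have i2 := hF.integrable a2
  have i3 : Integrable (fun x => Real.exp (t*|x|)) F := by
    refine (i1.add i2).mono (Continuous.aestronglyMeasurable (by fun_prop)) (ae_of_all _ fun x => ?_)
    rw [Real.norm_eq_abs, Real.abs_exp]
    exact (exp_abs_le t x).trans (le_abs_self _)
  refine ⟨i3, ?_⟩
  calc _ ≤ ∫ x, (Real.exp (t*x) + Real.exp (-t*x)) ∂F :=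
        integral_mono i3 (i1.add i2) fun x => exp_abs_le t x
    _ = Real.exp (lam F t) + Real.exp (lam F (-t)) := by
        rw [integral_add i1 i2, hF.exp_lam a1, hF.exp_lam a2]
    _ ≤ Real.exp (s^2*t^2) + Real.exp (s^2*t^2) := by
        have b1 := (abs_le.1 (hF.lam_bound a1)).2
        have b2 := (abs_le.1 (hF.lam_bound a2)).2
        rw [abs_neg] at b2
        rw [abs_of_nonneg ht0] at b1 b2
        have b3 : s^2*t^3 ≤ s^2*t^2 := by
          have : t^3 ≤ t^2 := by nlinarith [sq_nonneg t]
          gcongr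
        gcongr <;> nlinarith
    _ = _ := by ring

lemma gs_sq {s : ℝ} (hs : 0 < s) : Integrable (fun y => Real.exp (y^2/(4*s^2))) (gs 0 s) ∧
    ∫ y, Real.exp (y^2/(4*s^2)) ∂(gs 0 s) ≤ 2 := by
  have e : ∀ y, gaussianPDFReal 0 (s^2).toNNReal y • Real.exp (y^2/(4*s^2))
      = (√(2*Real.pi))⁻¹/s * Real.exp (-(1/(4*s^2))*y^2) := by
    intro y
    rw [pdf_eq hs, smul_eq_mul, mul_assoc, ← Real.exp_add]
    congr 2; field_simp; ring
  have hb : 0 < 1/(4*s^2) := by positivity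
  constructor
  · rw [gs, gaussianReal_of_var_ne_zero _ (sq_toNNReal_ne hs), 
      integrable_withDensity_iff_integrable_smul' (measurable_gaussianPDF _ _)
        (ae_of_all _ fun x => gaussianPDF_lt_top)]
    simp only [toReal_gaussianPDF, e]
    exact (integrable_exp_neg_mul_sq hb).const_mul _
  · rw [gs, integral_gaussianReal_eq_integral_smul (sq_toNNReal_ne hs)]
    simp only [e]
    rw [integral_const_mul, integral_gaussian]
    have : √(Real.pi/(1/(4*s^2))) = √(2*Real.pi) * (√2 * s) := by
      rw [← Real.sqrt_sq hs.le, ← Real.sqrt_mul (by norm_num), ← Real.sqrt_mul (by positivity),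
        Real.sqrt_sq hs.le]
      congr 1; field_simp; ring
    rw [this]
    have h2 : √2 ≤ 2 := by rw [Real.sqrt_le_left (by norm_num)]; norm_num
    have h3 : 0 < √(2*Real.pi) := by positivity
    calc _ = √2 := by field_simp
      _ ≤ 2 := h2

lemma exp_one_le : Real.exp 1 ≤ 3 := by have := Real.exp_one_lt_d9; linarith

lemma scaled : ∃ M : ℝ, 0 < M ∧ ∀ (F : Measure ℝ) (s : ℝ), IsProbabilityMeasure F → 0 ≤ s →
    Good F s → ∃ π : Measure (ℝ × ℝ), IsProbabilityMeasure π ∧ IsCoupling π F (gs 0 s) ∧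
      Integrable (fun p : ℝ × ℝ => Real.exp (|p.1-p.2|/M)) π ∧
      ∫ p : ℝ × ℝ, Real.exp (|p.1-p.2|/M) ∂π ≤ 13 := by
  obtain ⟨C, hC, hT⟩ := transport
  refine ⟨36*C, by linarith, fun F s _ hs0 hF => ?_⟩
  have hC0 : 0 < C := by linarith
  have hM : 0 < 36*C := by linarith
  have htri : ∀ x y : ℝ, Real.exp (|x-y|/(36*C)) ≤
      Real.exp (1/(36*C)*|x|) * Real.exp (1/(36*C)*|y|) := by
    intro x y
    rw [← Real.exp_add]
    apply Real.exp_le_exp.2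
    rw [← mul_add, one_div, inv_mul_eq_div]
    gcongr
    exact abs_sub x y
  rcases lt_or_ge s (3*C) with hs | hs
  · -- product coupling
    refine ⟨F.prod (gs 0 s), inferInstance, ⟨?_, ?_⟩, ?_⟩
    · rw [Measure.map_fst_prod]; simp
    · rw [Measure.map_snd_prod]; simp
    have ht : 1/(36*C) < 1 := by rw [div_lt_one hM]; linarith
    obtain ⟨i1, b1⟩ := hF.exp_abs (t := 1/(36*C)) (by positivity) ht
    obtain ⟨i2, b2⟩ := (good_gs s).exp_abs (t := 1/(36*C)) (by positivity) ht
    have i3 := i1.mul_prod i2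
    have i4 : Integrable (fun p : ℝ × ℝ => Real.exp (|p.1-p.2|/(36*C))) (F.prod (gs 0 s)) := by
      refine i3.mono (Continuous.aestronglyMeasurable (by fun_prop)) (ae_of_all _ fun p => ?_)
      rw [Real.norm_eq_abs, Real.abs_exp]
      exact (htri _ _).trans (le_abs_self _)
    refine ⟨i4, ?_⟩
    calc _ ≤ ∫ p : ℝ × ℝ, Real.exp (1/(36*C)*|p.1|) * Real.exp (1/(36*C)*|p.2|) ∂(F.prod (gs 0 s)) :=
          integral_mono i4 i3 fun p => htri p.1 p.2
      _ = (∫ x, Real.exp (1/(36*C)*|x|) ∂F) * ∫ y, Real.exp (1/(36*C)*|y|) ∂(gs 0 s) :=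
          integral_prod_mul (fun x => Real.exp (1/(36*C)*|x|)) (fun x => Real.exp (1/(36*C)*|x|))
      _ ≤ (2*Real.exp (s^2*(1/(36*C))^2)) * (2*Real.exp (s^2*(1/(36*C))^2)) := by
          gcongr
      _ = 4*Real.exp (2*(s^2*(1/(36*C))^2)) := by
          rw [two_mul (s^2*_), Real.exp_add]; ring
      _ ≤ 4*Real.exp 1 := by
          gcongr
          have : s*(1/(36*C)) ≤ 1/12 := by
            rw [mul_one_div, div_le_iff₀ hM]; linarith
          have h2 : 0 ≤ s*(1/(36*C)) := by positivity
          rw [← mul_pow]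
          nlinarith
      _ ≤ 13 := by have := exp_one_le; linarith
  · have hsp : 0 < s := by linarith
    obtain ⟨T, hTm, hTF, hTb⟩ := hT F s ‹_› hs hF
    have hmeas : Measurable (fun y => (T y, y)) := hTm.prodMk measurable_id
    have hpr := Measure.isProbabilityMeasure_map (μ := gs 0 s) hmeas.aemeasurable
    have hmc : ∀ μ : Measure (ℝ × ℝ), AEStronglyMeasurable
      (fun p : ℝ × ℝ => Real.exp (|p.1-p.2|/(36*C))) μ :=
        fun μ => Continuous.aestronglyMeasurable (by fun_prop)
    refine ⟨(gs 0 s).map (fun y => (T y, y)), hpr, ⟨?_, ?_⟩, ?_⟩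
    · rw [Measure.map_map measurable_fst hmeas]; exact hTF
    · rw [Measure.map_map measurable_snd hmeas]; exact Measure.map_id
    rw [integrable_map_measure (hmc _) hmeas.aemeasurable, integral_map hmeas.aemeasurable (hmc _)]
    set K : ℝ := (2/(36*C))^2 with hK
    -- integrability of the T part
    have ht : 2/(36*C) < 1 := by rw [div_lt_one hM]; linarith
    obtain ⟨i1, b1⟩ := hF.exp_abs (t := 2/(36*C)) (by positivity) ht
    have hmc2 : ∀ μ : Measure ℝ, AEStronglyMeasurable (fun x => Real.exp (2/(36*C)*|x|)) μ :=
        fun μ => Continuous.aestronglyMeasurable (by fun_prop)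
    rw [← hTF, integrable_map_measure (hmc2 _) hTm.aemeasurable] at i1
    rw [← hTF, integral_map hTm.aemeasurable (hmc2 _)] at b1
    obtain ⟨i2, b2⟩ := gs_sq hsp
    have i3 : Integrable (fun y => 3*Real.exp (y^2/(4*s^2)) +
        Real.exp (-(K*s^2)) * Real.exp (2/(36*C)*|T y|)) (gs 0 s) :=
      (i2.const_mul 3).add (i1.const_mul _)
    have hpt : ∀ᵐ y ∂(gs 0 s), Real.exp (|T y - y|/(36*C)) ≤ 3*Real.exp (y^2/(4*s^2)) +
        Real.exp (-(K*s^2)) * Real.exp (2/(36*C)*|T y|) := by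
      have hne : ∀ᵐ y ∂(gs 0 s), y ≠ 0 := by
        have := nullSingletonClass_gaussianReal (μ := 0) (sq_toNNReal_ne hsp)
        have h2 : (gs 0 s) {0} = 0 := by unfold gs; exact measure_singleton 0
        exact measure_eq_zero_iff_ae_notMem.1 h2
      filter_upwards [hne] with y hy
      have p1 := Real.exp_pos (y^2/(4*s^2))
      have p2 := Real.exp_pos (-(K*s^2))
      have p3 := Real.exp_pos (2/(36*C)*|T y|)
      by_cases hyc : |y| ≤ s^2/(3*C)
      · have h1 := hTb y hy hyc
        have h2 : |T y - y|/(36*C) ≤ 1 + y^2/(4*s^2) := by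
          rw [div_le_iff₀ hM]
          refine h1.trans ?_
          have h3 : y^2/(4*s^2) = (y^2/s^2)/4 := by field_simp
          have h4 : 0 ≤ C*(y^2/s^2) := by positivity
          rw [h3]; nlinarith
        have h3 := Real.exp_le_exp.2 h2
        rw [Real.exp_add] at h3
        have h4 : Real.exp 1 * Real.exp (y^2/(4*s^2)) ≤ 3*Real.exp (y^2/(4*s^2)) := by
          gcongr; exact exp_one_le
        have := mul_pos p2 p3
        linarith
      · push Not at hyc
        rw [div_lt_iff₀ (by positivity)] at hyc
        have h1 := htri (T y) y
        have h2 : Real.exp (1/(36*C)*|T y|) * Real.exp (1/(36*C)*|y|) ≤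
            Real.exp (-(K*s^2)) * Real.exp (2/(36*C)*|T y|) + Real.exp (K*s^2 + 2/(36*C)*|y|) := by
          have e1 : Real.exp (1/(36*C)*|T y|) * Real.exp (1/(36*C)*|y|)
            = Real.exp ((-(K*s^2) + 2/(36*C)*|T y|)/2) * Real.exp ((K*s^2 + 2/(36*C)*|y|)/2) := by
            rw [← Real.exp_add, ← Real.exp_add]; congr 1; ring
          have e2 : ∀ a, Real.exp a = Real.exp (a/2)^2 := fun a => by
            rw [← Real.exp_nat_mul]; congr 1; push_cast; ring
          rw [e1, ← Real.exp_add (-(K*s^2)) (2/(36*C)*|T y|), e2 (-(K*s^2) + 2/(36*C)*|T y|),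
            e2 (K*s^2 + 2/(36*C)*|y|)]
          nlinarith [sq_nonneg (Real.exp ((-(K*s^2) + 2/(36*C)*|T y|)/2) -
            Real.exp ((K*s^2 + 2/(36*C)*|y|)/2)),
            sq_nonneg (Real.exp ((-(K*s^2) + 2/(36*C)*|T y|)/2) +
            Real.exp ((K*s^2 + 2/(36*C)*|y|)/2))]
        have h3 : K*s^2 + 2/(36*C)*|y| ≤ y^2/(4*s^2) := by
          rw [le_div_iff₀ (by positivity)]
          have k1 : K*s^2*(4*s^2) = (s^2)^2*4*4/(36*C)^2 := by rw [hK]; field_simp; ring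
          have k2 : (s^2)^2 ≤ (|y| * (3*C))^2 := by gcongr
          have k3 : K*s^2*(4*s^2) ≤ y^2/9 := by
            rw [k1, div_le_iff₀ (by positivity)]
            rw [mul_pow, sq_abs] at k2
            nlinarith
          have k4 : 2/(36*C)*|y| * (4*s^2) ≤ 2/3*y^2 := by
            have : 2/(36*C)*|y| * (4*s^2) ≤ 2/(36*C)*|y| * (4*(|y| * (3*C))) := by gcongr
            refine this.trans (le_of_eq ?_)
            rw [← sq_abs y]; field_simp; ring
          nlinarith [sq_nonneg y]
        have h4 := Real.exp_le_exp.2 h3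
        linarith
    have i4 : Integrable ((fun p : ℝ × ℝ => Real.exp (|p.1-p.2|/(36*C))) ∘ fun y => (T y, y))
        (gs 0 s) := by
      refine i3.mono ((hmc _).comp_measurable hmeas) ?_
      filter_upwards [hpt] with y hy
      rw [Function.comp, Real.norm_eq_abs, Real.abs_exp]
      exact hy.trans (le_abs_self _)
    refine ⟨i4, ?_⟩
    calc _ ≤ ∫ y, (3*Real.exp (y^2/(4*s^2)) +
          Real.exp (-(K*s^2)) * Real.exp (2/(36*C)*|T y|)) ∂(gs 0 s) := integral_mono_ae i4 i3 hpt
      _ = 3*(∫ y, Real.exp (y^2/(4*s^2)) ∂(gs 0 s)) +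
          Real.exp (-(K*s^2)) * ∫ y, Real.exp (2/(36*C)*|T y|) ∂(gs 0 s) := by
          have i5 : Integrable (fun y => Real.exp (2/(36*C)*|T y|)) (gs 0 s) := i1
          rw [integral_add (i2.const_mul 3) (i5.const_mul _), integral_const_mul,
            integral_const_mul]
      _ ≤ 3*2 + Real.exp (-(K*s^2)) * (2*Real.exp (s^2*(2/(36*C))^2)) := by gcongr
      _ = 3*2 + 2 := by
          have : Real.exp (-(K*s^2)) * Real.exp (s^2*(2/(36*C))^2) = 1 := by
            rw [← Real.exp_add, hK, ← Real.exp_zero]; congr 1; ring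
          linear_combination 2*this
      _ ≤ 13 := by norm_num

end OW

/-- Theorem 2: `W_ψ(F, Φ_F) ≤ c₂ τ` for the Orlicz function `ψ(x) = exp|x| - 1`:
there is a coupling `π` of `F` and `Φ_F` with `∫ (exp(|x-y|/(c₂ τ)) - 1) dπ ≤ 1`. -/
theorem orlicz_wasserstein_estimate_A1 :
    ∃ c₂ : ℝ, 0 < c₂ ∧
      ∀ (τ : ℝ), 0 < τ →
        ∀ (F : Measure ℝ), IsProbabilityMeasure F → (∫ x : ℝ, x ∂F) = 0 → MemA1 τ F →
          ∃ π : Measure (ℝ × ℝ), IsProbabilityMeasure π ∧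
            IsCoupling π F (gaussianReal 0 (Real.toNNReal (variance id F))) ∧
            ∫ p : ℝ × ℝ, (Real.exp (|p.1 - p.2| / (c₂ * τ)) - 1) ∂π ≤ 1 := by
  obtain ⟨M, hM, hS⟩ := OW.scaled
  refine ⟨13*M, by positivity, fun τ hτ F hFp h0 hA => ?_⟩
  have hV0 : 0 ≤ variance id F := variance_nonneg _ _
  have hmd : Measurable (fun x : ℝ => x/τ) := by fun_prop
  have hp' := Measure.isProbabilityMeasure_map (μ := F) hmd.aemeasurable
  obtain ⟨ρ, hρ, ⟨hc1, hc2⟩, hi, hb⟩ := hS (F.map (fun x => x/τ)) (√(variance id F)/τ) hp'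
    (by positivity) (OW.good_of_A1 hτ h0 hA)
  have hm : Measurable (fun p : ℝ × ℝ => (τ*p.1, τ*p.2)) := by fun_prop
  have hmt : Measurable (fun x : ℝ => τ*x) := by fun_prop
  refine ⟨ρ.map (fun p => (τ*p.1, τ*p.2)), Measure.isProbabilityMeasure_map hm.aemeasurable,
    ⟨?_, ?_⟩, ?_⟩
  · rw [Measure.map_map measurable_fst hm]
    have e : Prod.fst ∘ (fun p : ℝ × ℝ => (τ*p.1, τ*p.2)) = (fun x => τ*x) ∘ Prod.fst := rfl
    rw [e, ← Measure.map_map hmt measurable_fst, hc1, Measure.map_map hmt hmd]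
    have : (fun x => τ*x) ∘ (fun x : ℝ => x/τ) = id := by
      ext x; simp only [Function.comp, id]; field_simp
    rw [this, Measure.map_id]
  · rw [Measure.map_map measurable_snd hm]
    have e : Prod.snd ∘ (fun p : ℝ × ℝ => (τ*p.1, τ*p.2)) = (fun x => τ*x) ∘ Prod.snd := rfl
    rw [e, ← Measure.map_map hmt measurable_snd, hc2, OW.gs, gaussianReal_map_const_mul, mul_zero]
    congr 1
    rw [← NNReal.coe_inj]
    push_cast
    rw [Real.coe_toNNReal _ (by positivity), Real.coe_toNNReal _ hV0, div_pow, Real.sq_sqrt hV0]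
    show τ^2 * _ = _
    field_simp
  · rw [integral_map hm.aemeasurable (Continuous.aestronglyMeasurable (by fun_prop))]
    have hpt : ∀ p : ℝ × ℝ, Real.exp (|τ*p.1 - τ*p.2|/(13*M*τ)) - 1
        ≤ (Real.exp (|p.1-p.2|/M) - 1)/13 := by
      intro p
      have e1 : |τ*p.1 - τ*p.2|/(13*M*τ) = |p.1-p.2|/M/13 := by
        rw [← mul_sub, abs_mul, abs_of_pos hτ]; field_simp
      rw [e1]
      set u := |p.1-p.2|/M with hu
      have h1 := one_add_mul_le_pow (a := Real.exp (u/13) - 1)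
        (by have := Real.exp_pos (u/13); linarith) 13
      rw [show 1 + (Real.exp (u/13) - 1) = Real.exp (u/13) by ring, ← Real.exp_nat_mul] at h1
      push_cast at h1
      rw [show 13*(u/13) = u by ring] at h1
      rw [le_div_iff₀ (by norm_num)]
      linarith
    have hi2 : Integrable (fun p : ℝ × ℝ => (Real.exp (|p.1-p.2|/M) - 1)/13) ρ :=
      (hi.sub (integrable_const 1)).div_const _
    have hnn : ∀ p : ℝ × ℝ, 0 ≤ Real.exp (|τ*p.1 - τ*p.2|/(13*M*τ)) - 1 := fun p => by
      rw [sub_nonneg, Real.one_le_exp_iff]; positivity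
    calc _ ≤ ∫ p : ℝ × ℝ, (Real.exp (|p.1-p.2|/M) - 1)/13 ∂ρ :=
          integral_mono_of_nonneg (ae_of_all _ hnn) hi2 (ae_of_all _ hpt)
      _ = ((∫ p : ℝ × ℝ, Real.exp (|p.1-p.2|/M) ∂ρ) - 1)/13 := by
          rw [integral_div, integral_sub hi (integrable_const 1)]; simp
      _ ≤ 1 := by linarith
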